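/- Let G be a discrete group and let Λ ⊆ G be a completely Sidon set with constant C ≥ 1. Let H be a complex Hilbert space and z : Λ → (H →L[ℂ] H) a function with sup_{t∈Λ} ‖z t‖ < 1. Then for every real ε with 0 < ε ≤ 1 there exist a complex Hilbert space Ĥ, a unitary representation π of G on Ĥ, and bounded operators ξ, η : H →L[ℂ] Ĥ with ‖ξ‖·‖η‖ ≤ C²/ε, such that the function Ψ(s) = (adjoint η) ∘ π(s) ∘ ξ satisfies Ψ(t) = z t for every t ∈ Λ and ‖Ψ(s)‖ ≤ C²·ε for every s ∈ G with s ∉ Λ. -/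

import Mathlib

/-- The operator `Op(a,v)` on the ℓ²-direct sum of `N` copies of `H`. -/
noncomputable def sidonOp {G : Type} {Λ : Set G} {N : ℕ}
    (a : ↥Λ →₀ Matrix (Fin N) (Fin N) ℂ)
    {H : Type} [NormedAddCommGroup H] [InnerProductSpace ℂ H]
    (v : ↥Λ → H →L[ℂ] H) :
    PiLp 2 (fun _ : Fin N => H) →L[ℂ] PiLp 2 (fun _ : Fin N => H) :=
  (((PiLp.continuousLinearEquiv 2 ℂ (fun _ : Fin N => H)).symm :
      (Fin N → H) →L[ℂ] PiLp 2 (fun _ : Fin N => H)).comp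
    ((ContinuousLinearMap.pi fun i =>
        ∑ t ∈ a.support, ∑ j, (a t i j) • ((v t).comp (ContinuousLinearMap.proj j))).comp
      (((PiLp.continuousLinearEquiv 2 ℂ (fun _ : Fin N => H)) :
        PiLp 2 (fun _ : Fin N => H) →L[ℂ] (Fin N → H)))))

/-- `Λ ⊆ G` is completely Sidon with constant `C`. -/
def IsCompletelySidon {G : Type} [Group G] (Λ : Set G) (C : ℝ) : Prop :=
  ∀ (N : ℕ) (a : ↥Λ →₀ Matrix (Fin N) (Fin N) ℂ) (D : ℝ), 0 ≤ D →
    (∀ (H' : Type) [NormedAddCommGroup H'] [InnerProductSpace ℂ H'] [CompleteSpace H']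
        (π : G →* unitary (H' →L[ℂ] H')),
        ‖sidonOp a (fun t => ((π (t : G) : unitary (H' →L[ℂ] H')) : H' →L[ℂ] H'))‖ ≤ D) →
    ∀ (K : Type) [NormedAddCommGroup K] [InnerProductSpace ℂ K] [CompleteSpace K]
      (u : ↥Λ → unitary (K →L[ℂ] K)),
      ‖sidonOp a (fun t => ((u t : unitary (K →L[ℂ] K)) : K →L[ℂ] K))‖ ≤ C * D

section CompletelySidonAux
open scoped ComplexOrder InnerProductSpace

lemma cs_kolmogorov {I : Type} (K : Matrix I I ℂ) (hK : K.PosSemidef) :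
    ∃ (E : Type) (_ : NormedAddCommGroup E) (_ : InnerProductSpace ℂ E) (_ : CompleteSpace E)
      (k : I → E), (∀ a b, ⟪k a, k b⟫_ℂ = K a b) ∧
      DenseRange (Finsupp.linearCombination ℂ k) := by
  let core : PreInnerProductSpace.Core ℂ (I →₀ ℂ) :=
    { inner := fun f g => f.sum fun a z => g.sum fun b w => star z * K a b * w
      conj_inner_symm := fun f g => by
        rw [Finsupp.sum_comm]
        simp only [map_finsuppSum]
        refine Finsupp.sum_congr fun a _ => Finsupp.sum_congr fun b _ => ?_
        rw [← hK.isHermitian.apply]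
        simp; ring
      add_left := fun _ _ _ => by
        rw [Finsupp.sum_add_index'] <;> simp [← Finsupp.sum_add, add_mul]
      smul_left := fun _ _ _ => by
        rw [Finsupp.sum_smul_index] <;> simp [Finsupp.mul_sum, mul_assoc]
      re_inner_nonneg := fun x => by
        have := hK.2 x
        exact (Complex.le_def.mp this).1 }
  let i1 : SeminormedAddCommGroup (I →₀ ℂ) :=
    InnerProductSpace.Core.toSeminormedAddCommGroup (𝕜 := ℂ)
  let i2 : InnerProductSpace ℂ (I →₀ ℂ) := InnerProductSpace.ofCore core
  have hin : ∀ f g : I →₀ ℂ, ⟪f, g⟫_ℂ = f.sum fun a z => g.sum fun b w => star z * K a b * w :=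
    fun f g => rfl
  refine ⟨UniformSpace.Completion (I →₀ ℂ), inferInstance, inferInstance, inferInstance,
    fun a => ((Finsupp.single a (1:ℂ) : I →₀ ℂ) : UniformSpace.Completion (I →₀ ℂ)), ?_, ?_⟩
  · intro a b
    rw [UniformSpace.Completion.inner_coe, hin]
    simp
  · have : (Finsupp.linearCombination ℂ fun a => ((Finsupp.single a (1:ℂ) : I →₀ ℂ) : UniformSpace.Completion (I →₀ ℂ)) : (I →₀ ℂ) → UniformSpace.Completion (I →₀ ℂ)) = ((↑) : (I →₀ ℂ) → UniformSpace.Completion (I →₀ ℂ)) := by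
      have h2 : (Finsupp.linearCombination ℂ fun a => ((Finsupp.single a (1:ℂ) : I →₀ ℂ) : UniformSpace.Completion (I →₀ ℂ))) = (UniformSpace.Completion.toComplL (𝕜 := ℂ) (E := I →₀ ℂ)).toLinearMap := by
        ext a
        simp
      rw [h2]; rfl
    rw [this]
    exact UniformSpace.Completion.denseRange_coe

lemma cs_gram_posSemidef {I : Type} {E : Type} [NormedAddCommGroup E] [InnerProductSpace ℂ E]
    (k : I → E) (K : Matrix I I ℂ) (h : ∀ a b, ⟪k a, k b⟫_ℂ = K a b) : K.PosSemidef := by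
  refine ⟨?_, fun x => ?_⟩
  · ext a b
    rw [Matrix.conjTranspose_apply, ← h, ← h]
    exact inner_conj_symm _ _
  · have : (x.sum fun i xi => x.sum fun j xj => star xi * K i j * xj) =
        ⟪Finsupp.linearCombination ℂ k x, Finsupp.linearCombination ℂ k x⟫_ℂ := by
      simp only [Finsupp.linearCombination_apply, Finsupp.sum_inner, Finsupp.inner_sum, h,
        inner_smul_left, inner_smul_right]
      rw [Finsupp.sum_comm]
      refine Finsupp.sum_congr fun a _ => ?_
      simp only [Finsupp.sum, Finset.mul_sum]
      refine Finset.sum_congr rfl fun b _ => ?_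
      simp; ring
    rw [this, inner_self_eq_norm_sq_to_K]
    simp

lemma cs_norm_linComb {I : Type} {E E' : Type} [NormedAddCommGroup E] [InnerProductSpace ℂ E]
    [NormedAddCommGroup E'] [InnerProductSpace ℂ E']
    (k : I → E) (k' : I → E') (h : ∀ a b, ⟪k a, k b⟫_ℂ = ⟪k' a, k' b⟫_ℂ) (x : I →₀ ℂ) :
    ‖Finsupp.linearCombination ℂ k x‖ = ‖Finsupp.linearCombination ℂ k' x‖ := by
  have : ⟪Finsupp.linearCombination ℂ k x, Finsupp.linearCombination ℂ k x⟫_ℂ =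
      ⟪Finsupp.linearCombination ℂ k' x, Finsupp.linearCombination ℂ k' x⟫_ℂ := by
    simp only [Finsupp.linearCombination_apply, Finsupp.sum_inner, Finsupp.inner_sum, h,
      inner_smul_left, inner_smul_right]
  rw [norm_eq_sqrt_re_inner (𝕜 := ℂ), this, ← norm_eq_sqrt_re_inner (𝕜 := ℂ)]

/-- GNS: invariant positive kernels give unitary representations. -/
lemma cs_gns {G : Type} [Group G] {I : Type} [MulAction G I] (K : Matrix I I ℂ) (hK : K.PosSemidef)
    (hinv : ∀ (g : G) a b, K (g • a) (g • b) = K a b) :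
    ∃ (E : Type) (_ : NormedAddCommGroup E) (_ : InnerProductSpace ℂ E) (_ : CompleteSpace E)
      (k : I → E) (π : G →* unitary (E →L[ℂ] E)), (∀ a b, ⟪k a, k b⟫_ℂ = K a b) ∧
      (∀ g a, (π g : E →L[ℂ] E) (k a) = k (g • a)) ∧
      DenseRange (Finsupp.linearCombination ℂ k) := by
  obtain ⟨E, _, _, _, k, hk, hd⟩ := cs_kolmogorov K hK
  let U : G → (E →L[ℂ] E) := fun g =>
    (Finsupp.linearCombination ℂ (fun a => k (g • a))).extendOfNorm (Finsupp.linearCombination ℂ k)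
  have hn : ∀ (g : G) x, ‖Finsupp.linearCombination ℂ (fun a => k (g • a)) x‖ =
      ‖Finsupp.linearCombination ℂ k x‖ := fun g x =>
    cs_norm_linComb _ _ (fun a b => by simp [hk, hinv]) x
  have hU : ∀ g x, U g (Finsupp.linearCombination ℂ k x) =
      Finsupp.linearCombination ℂ (fun a => k (g • a)) x := fun g x =>
    LinearMap.extendOfNorm_eq hd ⟨1, fun x => by rw [hn, one_mul]⟩ x
  have hUk : ∀ g a, U g (k a) = k (g • a) := fun g a => by
    have := hU g (Finsupp.single a 1)
    simpa using this
  have hext : ∀ S T : E →L[ℂ] E, (∀ a, S (k a) = T (k a)) → S = T := by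
    intro S T h
    refine DFunLike.coe_injective (hd.equalizer S.continuous T.continuous ?_)
    funext x
    simp [Finsupp.linearCombination_apply, Finsupp.sum, h]
  have hU1 : U 1 = 1 := hext _ _ fun a => by simp [hUk]
  have hUm : ∀ g h, U (g * h) = U g * U h := fun g h => hext _ _ fun a => by
    simp [hUk, mul_smul]
  have hUn : ∀ g x, ‖U g x‖ = ‖x‖ := by
    intro g x
    refine hd.induction_on (p := fun x => ‖U g x‖ = ‖x‖) x ?_ ?_
    · exact isClosed_eq (by fun_prop) (by fun_prop)
    · intro y; rw [hU, hn]
  have hadj : ∀ g, ContinuousLinearMap.adjoint (U g) * U g = 1 := fun g => by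
    exact (ContinuousLinearMap.norm_map_iff_adjoint_comp_self (U g)).mp (hUn g)
  have hadj' : ∀ g, ContinuousLinearMap.adjoint (U g) = U g⁻¹ := fun g => by
    calc _ = ContinuousLinearMap.adjoint (U g) * (U g * U g⁻¹) := by
            rw [← hUm]; simp [hU1]
      _ = _ := by rw [← mul_assoc, hadj, one_mul]
  refine ⟨E, inferInstance, inferInstance, inferInstance, k, ⟨⟨fun g => ⟨U g, ?_⟩, ?_⟩, ?_⟩, hk, hUk, hd⟩
  · rw [Unitary.mem_iff, ContinuousLinearMap.star_eq_adjoint]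
    refine ⟨hadj g, ?_⟩
    rw [hadj', ← hUm]; simp [hU1]
  · ext1; exact hU1
  · intro g h; ext1; exact hUm g h


lemma cs_exists_perm {α : Type} [Finite α] (R : α → α → Prop)
    (h1 : ∀ a b b', R a b → R a b' → b = b') (h2 : ∀ a a' b, R a b → R a' b → a = a') :
    ∃ σ : Equiv.Perm α, ∀ a b, R a b → σ a = b := by
  classical
  have := Fintype.ofFinite α
  choose f hf using fun a : {a // ∃ b, R a b} => a.2
  have hinj : Function.Injective f := fun a a' h => Subtype.ext (h2 _ _ (f a) (hf a) (h ▸ hf a'))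
  let e : {a // ∃ b, R a b} ≃ {b // b ∈ Set.range f} := Equiv.ofInjective f hinj
  refine ⟨e.extendSubtype, fun a b hab => ?_⟩
  have ha : ∃ b, R a b := ⟨b, hab⟩
  rw [Equiv.extendSubtype_apply_of_mem e a ha]
  exact h1 a _ _ (hf ⟨a, ha⟩) hab

lemma cs_resfin_one {X : Type} (w : FreeGroup X) (hw : w ≠ 1) :
    ∃ (n : ℕ) (p : FreeGroup X →* Equiv.Perm (Fin n)), p w ≠ 1 := by
  classical
  set L := w.toWord with hL
  have hred : ∀ i, ∀ (h : i + 1 < L.length), L[i].1 = L[i+1].1 → L[i].2 = L[i+1].2 := by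
    have : FreeGroup.IsReduced L := FreeGroup.isReduced_toWord
    intro i h
    exact List.isChain_iff_getElem.mp this i h
  let R : X → Fin (L.length + 1) → Fin (L.length + 1) → Prop := fun x a b =>
    (∃ h : b.1 < L.length, L[b.1] = (x, true) ∧ a.1 = b.1 + 1) ∨
    (∃ h : a.1 < L.length, L[a.1] = (x, false) ∧ b.1 = a.1 + 1)
  have key : ∀ x, ∃ σ : Equiv.Perm (Fin (L.length + 1)), ∀ a b, R x a b → σ a = b := by
    intro x
    apply cs_exists_perm
    · rintro a b b' (⟨h, hb, hab⟩ | ⟨h, hb, hab⟩) (⟨h', hb', hab'⟩ | ⟨h', hb', hab'⟩)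
      · ext; omega
      · have := hred b.1 (by omega)
        simp only [← hab, hb, hb'] at this
        simp at this
      · have := hred b'.1 (by omega)
        simp only [← hab', hb, hb'] at this
        simp at this
      · ext; omega
    · rintro a b b' (⟨h, hb, hab⟩ | ⟨h, hb, hab⟩) (⟨h', hb', hab'⟩ | ⟨h', hb', hab'⟩)
      · ext; omega
      · have := hred b.1 (by omega)
        simp only [← hab', hb, hb'] at this
        simp at this
      · have := hred a.1 (by omega)
        simp only [← hab, hb, hb'] at this
        simp at this
      · ext; omega
  choose σ hσ using key
  refine ⟨L.length + 1, FreeGroup.lift σ, ?_⟩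
  have main : ∀ B A : List (X × Bool), L = A ++ B →
      ((FreeGroup.lift σ (FreeGroup.mk B)) (Fin.last L.length)).1 = A.length := by
    intro B
    induction B with
    | nil => 
      intro A h
      simp [← FreeGroup.one_eq_mk, h]
    | cons b B ih =>
      intro A h
      have h1 := ih (A ++ [b]) (by simp [h])
      simp only [List.length_append, List.length_singleton] at h1
      have hlen : A.length < L.length := by rw [h]; simp
      have hget : L[A.length] = b := by simp [h]
      have h2 : FreeGroup.mk (b :: B) = FreeGroup.mk [b] * FreeGroup.mk B := by
        rw [FreeGroup.mul_mk]; rfl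
      rw [h2, map_mul, Equiv.Perm.mul_apply]
      set q := (FreeGroup.lift σ (FreeGroup.mk B)) (Fin.last L.length) with hq
      obtain ⟨x, bb⟩ := b
      cases bb
      · have := hσ x ⟨A.length, by omega⟩ q (Or.inr ⟨hlen, hget, h1⟩)
        simp only [FreeGroup.lift_mk, List.map_cons, List.map_nil, List.prod_singleton, cond_false]
        rw [← this]; simp
      · have := hσ x q ⟨A.length, by omega⟩ (Or.inl ⟨hlen, hget, h1⟩)
        simp only [FreeGroup.lift_mk, List.map_cons, List.map_nil, List.prod_singleton, cond_true]
        rw [this]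
  intro h
  have h1 := main L [] rfl
  have h3 : FreeGroup.mk L = w := FreeGroup.mk_toWord
  rw [h3, h] at h1
  simp only [Equiv.Perm.coe_one, id_eq, Fin.val_last, List.length_nil, List.length_eq_zero_iff] at h1
  exact hw (FreeGroup.toWord_eq_nil_iff.mp h1)

lemma cs_resfin {X : Type} (W : Finset (FreeGroup X)) :
    ∃ (n : ℕ) (_ : n ≠ 0) (p : FreeGroup X →* Equiv.Perm (Fin n)), ∀ w ∈ W, w ≠ 1 → ∀ i, p w i ≠ i := by
  classical
  choose n p hp using fun w : {w : FreeGroup X // w ≠ 1} => cs_resfin_one w.1 w.2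
  let Q := ∀ w : {w : {w : FreeGroup X // w ≠ 1} // w.1 ∈ W}, Equiv.Perm (Fin (n w.1))
  have : Finite {w : {w : FreeGroup X // w ≠ 1} // w.1 ∈ W} := by
    apply Finite.of_injective (β := W) (fun w => ⟨w.1.1, w.2⟩)
    rintro ⟨⟨a, _⟩, _⟩ ⟨⟨b, _⟩, _⟩ h
    simpa using h
  have hQ : Finite Q := inferInstance
  have := Fintype.ofFinite Q
  let P : FreeGroup X →* Q := MonoidHom.pi fun w => p w.1
  let e := Fintype.equivFin Q
  refine ⟨Fintype.card Q, Fintype.card_ne_zero, 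
    (e.permCongrHom.toMonoidHom.comp (MulAction.toPermHom Q Q)).comp P, ?_⟩
  intro w hw h1 i hi
  apply hp ⟨w, h1⟩
  have : P w = 1 := by
    simp [Equiv.permCongrHom] at hi
    rw [← Equiv.eq_symm_apply] at hi
    simpa using hi
  exact congrFun this ⟨⟨w, h1⟩, hw⟩


section P4
lemma cs_red_append {X : Type} (L₁ L₂ : List (X × Bool)) (h : FreeGroup.IsReduced (L₁ ++ L₂)) :
    FreeGroup.IsReduced L₁ ∧ FreeGroup.IsReduced L₂ :=
  ⟨List.IsChain.left_of_append h, List.IsChain.right_of_append h⟩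

variable {X H : Type} [NormedAddCommGroup H] [InnerProductSpace ℂ H] [CompleteSpace H]

noncomputable def csLet (c : X → H →L[ℂ] H) (l : X × Bool) : H →L[ℂ] H :=
  cond l.2 (c l.1) (ContinuousLinearMap.adjoint (c l.1))

open Classical in
noncomputable def csPhi (c : X → H →L[ℂ] H) (w : FreeGroup X) : H →L[ℂ] H :=
  (w.toWord.map (csLet c)).prod

lemma csLet_not (c : X → H →L[ℂ] H) (l : X × Bool) :
    csLet c (l.1, !l.2) = star (csLet c l) := by
  rcases l with ⟨x, _ | _⟩ <;> simp [csLet, ContinuousLinearMap.star_eq_adjoint]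

lemma csLet_norm (c : X → H →L[ℂ] H) (r : ℝ) (hc : ∀ x, ‖c x‖ ≤ r) (l : X × Bool) :
    ‖csLet c l‖ ≤ r := by
  rcases l with ⟨x, _ | _⟩ <;> simp [csLet, hc]

lemma csPhi_inv (c : X → H →L[ℂ] H) (w : FreeGroup X) : csPhi c w⁻¹ = star (csPhi c w) := by
  classical
  have : ∀ L : List (X × Bool), ((FreeGroup.invRev L).map (csLet c)).prod =
      star ((L.map (csLet c)).prod) := by
    intro L
    induction L with
    | nil => simp
    | cons a L ih =>
      rw [FreeGroup.invRev_cons, List.map_append, List.prod_append, ih]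
      simp [FreeGroup.invRev, csLet_not]
  have h2 := this w.toWord
  rw [← FreeGroup.toWord_inv] at h2
  unfold csPhi
  convert h2

lemma csPhi_of (c : X → H →L[ℂ] H) (x : X) : csPhi c (FreeGroup.of x) = c x := by
  simp [csPhi, FreeGroup.toWord_of, csLet]

lemma csPhi_one (c : X → H →L[ℂ] H) : csPhi c 1 = 1 := by
  simp [csPhi]

open Classical in
lemma csPhi_norm (c : X → H →L[ℂ] H) (r : ℝ) (hr : 0 ≤ r) (hc : ∀ x, ‖c x‖ ≤ r) (w : FreeGroup X) :
    ‖csPhi c w‖ ≤ r ^ w.norm := by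
  have : ∀ L : List (X × Bool), ‖(L.map (csLet c)).prod‖ ≤ r ^ L.length := by
    intro L
    induction L with
    | nil => simpa using! ContinuousLinearMap.norm_id_le (𝕜 := ℂ) (E := H)
    | cons a L ih =>
      rw [List.map_cons, List.prod_cons, List.length_cons, pow_succ']
      exact (norm_mul_le _ _).trans (mul_le_mul (csLet_norm c r hc a) ih (norm_nonneg _) hr)
  exact this _

lemma cs_defect (a : H →L[ℂ] H) (ha : ‖a‖ ≤ 1) : ∃ D : H →L[ℂ] H, star D * D = 1 - star a * a := by
  have : 0 ≤ 1 - star a * a := by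
    rw [ContinuousLinearMap.nonneg_iff_isPositive]
    refine ⟨?_, fun x => ?_⟩
    · have : IsSelfAdjoint (1 - star a * a) :=
        (IsSelfAdjoint.one _).sub (IsSelfAdjoint.star_mul_self a)
      exact ContinuousLinearMap.isSelfAdjoint_iff_isSymmetric.mp this
    · rw [ContinuousLinearMap.reApplyInnerSelf_apply]
      have h1 : ‖a x‖ ^ 2 ≤ ‖x‖ ^ 2 := by
        have := a.le_of_opNorm_le ha x
        rw [one_mul] at this
        gcongr
      have h2 : RCLike.re ⟪(1 - star a * a) x, x⟫_ℂ = ‖x‖ ^ 2 - ‖a x‖ ^ 2 := by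
        have h3 : (1 - star a * a) x = x - ContinuousLinearMap.adjoint a (a x) := rfl
        rw [h3, inner_sub_left, ContinuousLinearMap.adjoint_inner_left, map_sub,
          inner_self_eq_norm_sq, inner_self_eq_norm_sq]
      rw [h2]
      linarith
  obtain ⟨D, hD⟩ := CStarAlgebra.nonneg_iff_eq_star_mul_self.mp this
  exact ⟨D, hD.symm⟩

open Classical in
noncomputable def csVec (c : X → H →L[ℂ] H) (D : X × Bool → H →L[ℂ] H) :
    List (X × Bool) → H → lp (fun _ : List (X × Bool) => H) 2
  | [], h => lp.single 2 [] h
  | (l :: L), h => csVec c D L (csLet c l h) + lp.single 2 (l :: L) (D l h)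

lemma csVec_zero (c : X → H →L[ℂ] H) (D : X × Bool → H →L[ℂ] H) (L M : List (X × Bool))
    (h : H) (hl : L.length ≤ M.length) (hne : L ≠ M) : csVec c D L h M = 0 := by
  classical
  induction L generalizing h with
  | nil => 
    simp only [csVec, lp.coeFn_single]
    exact Pi.single_eq_of_ne (Ne.symm hne) _
  | cons l L ih => 
    simp only [csVec, lp.coeFn_add, Pi.add_apply, lp.coeFn_single]
    rw [Pi.single_eq_of_ne (Ne.symm hne), ih, add_zero]
    · simp at hl; omega
    · rintro rfl; simp at hl

open Classical in
/-- cancellation -/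
lemma cs_word (y x : List (X × Bool)) (hy : FreeGroup.IsReduced y) (hx : FreeGroup.IsReduced x) :
    ∃ p y' x', y = p ++ y' ∧ x = p ++ x' ∧ FreeGroup.IsReduced (FreeGroup.invRev y' ++ x') := by
  have hinv : ∀ L : List (X × Bool), FreeGroup.IsReduced L → FreeGroup.IsReduced (FreeGroup.invRev L) := by
    intro L hL
    have : L = (FreeGroup.mk L).toWord := by rw [FreeGroup.toWord_mk, hL.reduce_eq]
    rw [this, ← FreeGroup.toWord_inv]
    exact FreeGroup.isReduced_toWord
  induction y generalizing x with
  | nil => exact ⟨[], [], x, rfl, rfl, hx⟩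
  | cons a y ih =>
    cases x with
    | nil => exact ⟨[], a :: y, [], rfl, rfl, by simpa using hinv _ hy⟩
    | cons b x =>
      by_cases hab : a = b
      · subst hab
        obtain ⟨p, y', x', h1, h2, h3⟩ := ih x (cs_red_append [a] _ hy).2 (cs_red_append [a] _ hx).2
        exact ⟨a :: p, y', x', by simp [h1], by simp [h2], h3⟩
      · refine ⟨[], _, _, rfl, rfl, ?_⟩
        refine List.isChain_append.mpr ⟨hinv _ hy, hx, ?_⟩
        intro u hu v hv
        simp [FreeGroup.invRev] at hu hv
        subst hu hv
        rcases a with ⟨a, _ | _⟩ <;> rcases b with ⟨b, _ | _⟩ <;> simp_all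

lemma csPhi_mk (c : X → H →L[ℂ] H) (L : List (X × Bool)) (hL : FreeGroup.IsReduced L) :
    csPhi c (FreeGroup.mk L) = (L.map (csLet c)).prod := by
  classical
  have : (FreeGroup.mk L).toWord = L := by rw [FreeGroup.toWord_mk, hL.reduce_eq]
  unfold csPhi
  rw [← this]
  congr!

lemma csPhi_step (c : X → H →L[ℂ] H) (y x : List (X × Bool)) (l : X × Bool)
    (hy : FreeGroup.IsReduced y) (hx : FreeGroup.IsReduced (x ++ [l]))
    (hlen : y.length ≤ (x ++ [l]).length) (hne : y ≠ x ++ [l]) :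
    csPhi c ((FreeGroup.mk y)⁻¹ * FreeGroup.mk (x ++ [l])) =
      csPhi c ((FreeGroup.mk y)⁻¹ * FreeGroup.mk x) * csLet c l := by
  obtain ⟨p, y', x', h1, h2, h3⟩ := cs_word y _ hy hx
  have hx' : x' ≠ [] := by
    rintro rfl
    apply hne
    rw [h1, h2]
    rw [h1, h2] at hlen
    simp at hlen
    simp [hlen]
  obtain ⟨x'', m, rfl⟩ : ∃ x'' m, x' = x'' ++ [m] :=
    ⟨x'.dropLast, x'.getLast hx', (List.dropLast_append_getLast hx').symm⟩
  rw [← List.append_assoc] at h2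
  obtain ⟨h4, h5⟩ := List.append_inj' h2 rfl
  simp only [List.cons.injEq, and_true] at h5
  subst h5 h4 h1
  have e1 : (FreeGroup.mk (p ++ y'))⁻¹ * FreeGroup.mk (p ++ x'' ++ [l]) =
      FreeGroup.mk (FreeGroup.invRev y' ++ (x'' ++ [l])) := by
    simp only [← FreeGroup.mul_mk, ← FreeGroup.inv_mk]
    group
  have e2 : (FreeGroup.mk (p ++ y'))⁻¹ * FreeGroup.mk (p ++ x'') =
      FreeGroup.mk (FreeGroup.invRev y' ++ x'') := by
    simp only [← FreeGroup.mul_mk, ← FreeGroup.inv_mk]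
    group
  rw [e1, e2, csPhi_mk _ _ h3, csPhi_mk]
  · simp [mul_assoc]
  · exact (cs_red_append _ [l] (by rw [List.append_assoc]; exact h3)).1

lemma csVec_inner (c : X → H →L[ℂ] H) (D : X × Bool → H →L[ℂ] H)
    (hD : ∀ l, star (D l) * D l = 1 - star (csLet c l) * csLet c l) (n : ℕ) :
    ∀ (y x : List (X × Bool)) (g h : H), FreeGroup.IsReduced y → FreeGroup.IsReduced x →
      y.length + x.length ≤ n →
      ⟪csVec c D y.reverse g, csVec c D x.reverse h⟫_ℂ =
        ⟪g, csPhi c ((FreeGroup.mk y)⁻¹ * FreeGroup.mk x) h⟫_ℂ := by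
  classical
  induction n with
  | zero =>
    intro y x g h hy hx hn
    obtain rfl : y = [] := List.length_eq_zero_iff.mp (by omega)
    obtain rfl : x = [] := List.length_eq_zero_iff.mp (by omega)
    simp [csVec, lp.inner_single_left, csPhi_one, ← FreeGroup.one_eq_mk]
  | succ n ih =>
    have main : ∀ (y x : List (X × Bool)) (g h : H), FreeGroup.IsReduced y → FreeGroup.IsReduced x →
        y.length + x.length ≤ n + 1 → y.length ≤ x.length →
        ⟪csVec c D y.reverse g, csVec c D x.reverse h⟫_ℂ =
          ⟪g, csPhi c ((FreeGroup.mk y)⁻¹ * FreeGroup.mk x) h⟫_ℂ := by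
      intro y x g h hy hx hn hle
      by_cases hxe : x = []
      · subst hxe
        obtain rfl : y = [] := by simpa using hle
        exact ih _ _ _ _ hy hx (by simp)
      obtain ⟨x', l, rfl⟩ : ∃ x'' m, x = x'' ++ [m] :=
        ⟨x.dropLast, x.getLast hxe, (List.dropLast_append_getLast hxe).symm⟩
      have hx' : FreeGroup.IsReduced x' := (cs_red_append _ [l] hx).1
      by_cases hyx : y = x' ++ [l]
      · subst hyx
        have h0 := csVec_zero c D x'.reverse (l :: x'.reverse) (csLet c l g) (by simp) (by simp)
        have h0' := csVec_zero c D x'.reverse (l :: x'.reverse) (csLet c l h) (by simp) (by simp)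
        rw [List.reverse_append]
        simp only [List.reverse_singleton, List.singleton_append, csVec, inner_add_left,
          inner_add_right, lp.inner_single_left, lp.inner_single_right, h0, h0', lp.coeFn_single,
          Pi.single_eq_same, inner_zero_left, inner_zero_right]
        rw [ih x' x' _ _ hx' hx' (by simp at hn; omega)]
        have h1 : ⟪D l g, D l h⟫_ℂ = ⟪g, (star (D l) * D l) h⟫_ℂ := by
          simp [ContinuousLinearMap.star_eq_adjoint, ContinuousLinearMap.adjoint_inner_right]
        rw [h1, hD, inv_mul_cancel, inv_mul_cancel, csPhi_one]
        simp [ContinuousLinearMap.star_eq_adjoint, ContinuousLinearMap.adjoint_inner_right]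
      · rw [csPhi_step c y x' l hy hx hle hyx, List.reverse_append]
        simp only [List.reverse_singleton, List.singleton_append, csVec, 
          inner_add_right, lp.inner_single_right]
        rw [csVec_zero, ih y x' _ _ hy hx' (by simp at hn; omega)]
        · simp
        · simpa using hle
        · intro h
          apply hyx
          rw [← List.reverse_inj]; simp [h]
    intro y x g h hy hx hn
    rcases le_total y.length x.length with hle | hle
    · exact main y x g h hy hx hn hle
    · rw [← inner_conj_symm, main x y h g hx hy (by omega) hle]
      have : (FreeGroup.mk y)⁻¹ * FreeGroup.mk x = ((FreeGroup.mk x)⁻¹ * FreeGroup.mk y)⁻¹ := by group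
      rw [this, csPhi_inv, ContinuousLinearMap.star_eq_adjoint, ContinuousLinearMap.adjoint_inner_right,
        inner_conj_symm]

lemma csPhi_posSemidef (c : X → H →L[ℂ] H) (hc : ∀ x, ‖c x‖ ≤ 1) :
    (Matrix.of fun a b : FreeGroup X × H => ⟪a.2, csPhi c (a.1⁻¹ * b.1) b.2⟫_ℂ).PosSemidef := by
  classical
  choose D hD using fun l => cs_defect (csLet c l) (csLet_norm c 1 hc l)
  refine cs_gram_posSemidef (fun a => csVec c D a.1.toWord.reverse a.2) _ ?_
  intro a b
  rw [csVec_inner c D hD _ _ _ _ _ FreeGroup.isReduced_toWord FreeGroup.isReduced_toWord le_rfl]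
  simp [FreeGroup.mk_toWord]
end P4


section P5
lemma cs_inner_single {R V : Type} [Fintype R] [DecidableEq R] [NormedAddCommGroup V]
    [InnerProductSpace ℂ V] (a : R) (v : V) (y : PiLp 2 (fun _ : R => V)) :
    ⟪(WithLp.toLp 2 (Pi.single a v) : PiLp 2 (fun _ : R => V)), y⟫_ℂ = ⟪v, y a⟫_ℂ := by
  rw [PiLp.inner_apply, Finset.sum_eq_single a]
  · simp
  · intro b _ hb
    simp [Pi.single_eq_of_ne hb]
  · simp

lemma cs_JJ {R V E : Type} [Fintype R] [DecidableEq R]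
    [NormedAddCommGroup V] [InnerProductSpace ℂ V] [CompleteSpace V]
    [NormedAddCommGroup E] [InnerProductSpace ℂ E] [CompleteSpace E]
    (J : R → V →L[ℂ] E) : ∃ JJ : PiLp 2 (fun _ : R => V) →L[ℂ] E,
      (∀ x, JJ x = ∑ r, J r (x r)) ∧ (∀ b v, JJ (WithLp.toLp 2 (Pi.single b v)) = J b v) ∧
      (∀ e a, (ContinuousLinearMap.adjoint JJ e) a = ContinuousLinearMap.adjoint (J a) e) := by
  have hJJ : ∀ x : PiLp 2 (fun _ : R => V),
      (∑ r, (J r).comp (PiLp.proj 2 (fun _ : R => V) r)) x = ∑ r, J r (x r) := fun x => by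
    rw [sum_apply]; rfl
  have hJs : ∀ b v, (∑ r, (J r).comp (PiLp.proj 2 (fun _ : R => V) r))
      (WithLp.toLp 2 (Pi.single b v)) = J b v := by
    intro b v
    rw [hJJ, Finset.sum_eq_single b]
    · simp
    · intro c _ hc; simp [Pi.single_eq_of_ne hc]
    · simp
  refine ⟨_, hJJ, hJs, ?_⟩
  intro e a
  refine ext_inner_left ℂ fun v => ?_
  rw [← cs_inner_single a v, ContinuousLinearMap.adjoint_inner_right,
    ContinuousLinearMap.adjoint_inner_right, hJs]

lemma cs_Dg {R V : Type} [Fintype R] [NormedAddCommGroup V] [InnerProductSpace ℂ V]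
    [CompleteSpace V] (T : V →L[ℂ] V) :
    ∃ D : PiLp 2 (fun _ : R => V) →L[ℂ] PiLp 2 (fun _ : R => V), ∀ y a, (D y) a = T (y a) := by
  refine ⟨((PiLp.continuousLinearEquiv 2 ℂ (fun _ : R => V)).symm : (R → V) →L[ℂ] _).comp
    (ContinuousLinearMap.pi fun a => T.comp (PiLp.proj 2 (fun _ : R => V) a)), fun y a => rfl⟩

lemma cs_sqrt {L E : Type} [NormedAddCommGroup L] [InnerProductSpace ℂ L] [CompleteSpace L]
    [NormedAddCommGroup E] [InnerProductSpace ℂ E] [CompleteSpace E] (JJ : L →L[ℂ] E) :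
    ∃ S : L →L[ℂ] L, (∀ x y, ⟪S x, S y⟫_ℂ = ⟪x, JJ.adjoint (JJ y)⟫_ℂ) ∧
      ∀ D : L →L[ℂ] L, Commute (JJ.adjoint.comp JJ) D → Commute S D := by
  have hpos : 0 ≤ JJ.adjoint.comp JJ := by
    rw [ContinuousLinearMap.nonneg_iff_isPositive]
    exact ContinuousLinearMap.isPositive_adjoint_comp_self JJ
  have hSS := CFC.sqrt_mul_sqrt_self (JJ.adjoint.comp JJ) hpos
  have hSsa : ContinuousLinearMap.adjoint (CFC.sqrt (JJ.adjoint.comp JJ)) =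
      CFC.sqrt (JJ.adjoint.comp JJ) := by
    rw [← ContinuousLinearMap.star_eq_adjoint]
    exact IsSelfAdjoint.of_nonneg (CFC.sqrt_nonneg _)
  refine ⟨CFC.sqrt (JJ.adjoint.comp JJ), fun x y => ?_, fun D hD => hD.cfcₙ_nnreal NNReal.sqrt⟩
  rw [← ContinuousLinearMap.adjoint_inner_right, hSsa]
  exact congrArg (fun T : L →L[ℂ] L => ⟪x, T y⟫_ℂ) hSS

/-- commuting Schur product -/
lemma cs_commSchur {R V E1 E2 : Type} [Fintype R]
    [NormedAddCommGroup V] [InnerProductSpace ℂ V] [CompleteSpace V]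
    [NormedAddCommGroup E1] [InnerProductSpace ℂ E1] [CompleteSpace E1]
    [NormedAddCommGroup E2] [InnerProductSpace ℂ E2] [CompleteSpace E2]
    (J : R → V →L[ℂ] E1) (m : R → V →L[ℂ] E2)
    (hcomm : ∀ a b r s v, ContinuousLinearMap.adjoint (m r) (m s
        (ContinuousLinearMap.adjoint (J a) (J b v))) =
      ContinuousLinearMap.adjoint (J a) (J b (ContinuousLinearMap.adjoint (m r) (m s v))))
    (d : V) :
    (Matrix.of fun r s => ⟪m r d, m s (ContinuousLinearMap.adjoint (J r) (J s d))⟫_ℂ).PosSemidef := by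
  classical
  obtain ⟨JJ, hJJ, hJs, hJa⟩ := cs_JJ J
  obtain ⟨S, hS, hSc⟩ := cs_sqrt JJ
  have hD : ∀ r s, ∃ D : PiLp 2 (fun _ : R => V) →L[ℂ] PiLp 2 (fun _ : R => V),
      ∀ y a, (D y) a = (m r).adjoint (m s (y a)) := fun r s => cs_Dg ((m r).adjoint.comp (m s))
  choose Dg hDga using hD
  have hc0 : ∀ r s x, JJ.adjoint (JJ (Dg r s x)) = Dg r s (JJ.adjoint (JJ x)) := by
    intro r s x
    ext a
    rw [hDga, hJa, hJa, hJJ, hJJ]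
    simp only [map_sum, hDga, hcomm]
  have hc1 : ∀ r s, Commute (JJ.adjoint.comp JJ) (Dg r s) := by
    intro r s
    exact ContinuousLinearMap.ext fun x => hc0 r s x
  have hc2 : ∀ r s, Commute S (Dg r s) := fun r s => hSc _ (hc1 r s)
  refine cs_gram_posSemidef (fun r => (WithLp.toLp 2 fun a =>
    m r ((S (WithLp.toLp 2 (Pi.single r d))) a) : PiLp 2 (fun _ : R => E2))) _ ?_
  intro r s
  have e1 : ∀ x y : PiLp 2 (fun _ : R => V), ∑ a, ⟪m r (x a), m s (y a)⟫_ℂ = ⟪x, Dg r s y⟫_ℂ := by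
    intro x y
    rw [PiLp.inner_apply]
    simp only [hDga, ContinuousLinearMap.adjoint_inner_right]
  have e2 : ∀ x, Dg r s (S x) = S (Dg r s x) := fun x =>
    (DFunLike.congr_fun (hc2 r s).eq x).symm
  rw [PiLp.inner_apply]
  refine (e1 _ _).trans ?_
  rw [e2, hS, hc0, cs_inner_single, hDga, hJa, hJs, ContinuousLinearMap.adjoint_inner_right]
  rfl

lemma cs_orthOp {N E : Type} [DecidableEq N] [NormedAddCommGroup E] [InnerProductSpace ℂ E]
    [CompleteSpace E] (f : N → E) (κ : ℝ) (hn : ∀ v, ‖f v‖ = κ)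
    (ho : ∀ v w, v ≠ w → ⟪f v, f w⟫_ℂ = 0) :
    ∃ J : lp (fun _ : N => ℂ) 2 →L[ℂ] E, ∀ v, J (lp.single 2 v (1:ℂ)) = f v := by
  by_cases hκ : κ = 0
  · refine ⟨0, fun v => ?_⟩
    have := hn v
    rw [hκ, norm_eq_zero] at this
    simp [this]
  · have hon : Orthonormal ℂ (fun v => ((κ⁻¹ : ℝ) : ℂ) • f v) := by
      constructor
      · intro v
        have h0 : 0 ≤ κ := by
          rw [← hn v]; exact norm_nonneg _
        rw [norm_smul, hn]
        simp [abs_of_nonneg h0, hκ]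
      · intro v w hvw
        simp [inner_smul_left, inner_smul_right, ho v w hvw]
    refine ⟨(κ : ℂ) • hon.orthogonalFamily.linearIsometry.toContinuousLinearMap, fun v => ?_⟩
    simp only [smul_apply, LinearIsometry.coe_toContinuousLinearMap]
    rw [OrthogonalFamily.linearIsometry_apply_single]
    simp [smul_smul, hκ]

lemma cs_fiber {N I : Type} [Group N] [MulAction N I] (K1 K2 : Matrix I I ℂ)
    (h1 : K1.PosSemidef) (h2 : K2.PosSemidef)
    (i1 : ∀ (v : N) a b, K1 (v • a) (v • b) = K1 a b)
    (i2 : ∀ (v : N) a b, K2 (v • a) (v • b) = K2 a b)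
    (o1 : ∀ (v : N) a, v ≠ 1 → K1 a (v • a) = 0)
    (o2 : ∀ (v : N) a, v ≠ 1 → K2 a (v • a) = 0) :
    (Matrix.of fun a b => ∑' v : N, K1 a (v • b) * K2 a (v • b)).PosSemidef := by
  classical
  obtain ⟨E1, _, _, _, k1, hk1, -⟩ := cs_kolmogorov K1 h1
  obtain ⟨E2, _, _, _, k2, hk2, -⟩ := cs_kolmogorov K2 h2
  have nrm : ∀ {E : Type} [NormedAddCommGroup E] [InnerProductSpace ℂ E] (x y : E),
      ⟪x, x⟫_ℂ = ⟪y, y⟫_ℂ → ‖x‖ = ‖y‖ := by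
    intro E _ _ x y h
    rw [norm_eq_sqrt_re_inner (𝕜 := ℂ), h, ← norm_eq_sqrt_re_inner (𝕜 := ℂ)]
  have hJ : ∀ a, ∃ J : lp (fun _ : N => ℂ) 2 →L[ℂ] E1, ∀ v, J (lp.single 2 v (1:ℂ)) = k1 (v • a) := by
    intro a
    refine cs_orthOp (fun v : N => k1 (v • a)) ‖k1 a‖ (fun v => nrm _ _ (by rw [hk1, hk1, i1])) ?_
    intro v w hvw
    rw [hk1, ← i1 v⁻¹, inv_smul_smul, smul_smul]
    exact o1 _ _ (fun h => hvw (inv_mul_eq_one.mp h))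
  have hm : ∀ a, ∃ J : lp (fun _ : N => ℂ) 2 →L[ℂ] E2, ∀ v, J (lp.single 2 v (1:ℂ)) = k2 (v⁻¹ • a) := by
    intro a
    refine cs_orthOp (fun v : N => k2 (v⁻¹ • a)) ‖k2 a‖ (fun v => nrm _ _ (by rw [hk2, hk2, i2])) ?_
    intro v w hvw
    rw [hk2, ← i2 v, smul_inv_smul, smul_smul]
    exact o2 _ _ (fun h => hvw (mul_inv_eq_one.mp h))
  choose J hJ using hJ
  choose m hm using hm
  let δ : N → lp (fun _ : N => ℂ) 2 := fun v => lp.single 2 v (1:ℂ)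
  have hcoord : ∀ v (x : lp (fun _ : N => ℂ) 2), ⟪δ v, x⟫_ℂ = x v := by
    intro v x; simp [δ, lp.inner_single_left]
  have hext : ∀ {S T : lp (fun _ : N => ℂ) 2 →L[ℂ] lp (fun _ : N => ℂ) 2},
      (∀ y x, ⟪δ y, S (δ x)⟫_ℂ = ⟪δ y, T (δ x)⟫_ℂ) → S = T := by
    intro S T h
    refine lp.ext_continuousLinearMap ENNReal.ofNat_ne_top fun x => ?_
    ext y
    have := h y x
    rw [hcoord, hcoord] at this
    exact this
  have hA : ∀ a b y x, ⟪δ y, (J a).adjoint (J b (δ x))⟫_ℂ = K1 a ((y⁻¹ * x) • b) := by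
    intro a b y x
    rw [ContinuousLinearMap.adjoint_inner_right, hJ, hJ, hk1, ← i1 y⁻¹, inv_smul_smul, smul_smul]
  have hM : ∀ a b y x, ⟪δ y, (m a).adjoint (m b (δ x))⟫_ℂ = K2 a ((y * x⁻¹) • b) := by
    intro a b y x
    rw [ContinuousLinearMap.adjoint_inner_right, hm, hm, hk2, ← i2 y, smul_inv_smul, smul_smul]
  have hM' : ∀ r s y x, ⟪(m s).adjoint (m r (δ y)), δ x⟫_ℂ = K2 r ((y * x⁻¹) • s) := by
    intro r s y x
    rw [ContinuousLinearMap.adjoint_inner_left, ← hM, ContinuousLinearMap.adjoint_inner_right]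
  have hA' : ∀ r s y x, ⟪(J s).adjoint (J r (δ y)), δ x⟫_ℂ = K1 r ((y⁻¹ * x) • s) := by
    intro r s y x
    rw [ContinuousLinearMap.adjoint_inner_left, ← hA, ContinuousLinearMap.adjoint_inner_right]
  have hexp : ∀ x y : lp (fun _ : N => ℂ) 2, ⟪x, y⟫_ℂ = ∑' z, ⟪x, δ z⟫_ℂ * ⟪δ z, y⟫_ℂ := by
    intro x y
    rw [lp.inner_eq_tsum]
    refine tsum_congr fun z => ?_
    rw [hcoord, ← inner_conj_symm x (δ z), hcoord]
    simp [mul_comm]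
  have hMA : ∀ a b r s y x, ⟪δ y, (m r).adjoint (m s ((J a).adjoint (J b (δ x))))⟫_ℂ =
      ∑' z, K2 r ((y * z⁻¹) • s) * K1 a ((z⁻¹ * x) • b) := by
    intro a b r s y x
    have : ⟪δ y, (m r).adjoint (m s ((J a).adjoint (J b (δ x))))⟫_ℂ = 
        ⟪(m s).adjoint (m r (δ y)), (J a).adjoint (J b (δ x))⟫_ℂ := by
      rw [ContinuousLinearMap.adjoint_inner_right, ContinuousLinearMap.adjoint_inner_left]
    rw [this, hexp]
    refine tsum_congr fun z => ?_
    rw [hM', hA]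
  have hAM : ∀ a b r s y x, ⟪δ y, (J a).adjoint (J b ((m r).adjoint (m s (δ x))))⟫_ℂ =
      ∑' z, K1 a ((y⁻¹ * z) • b) * K2 r ((z * x⁻¹) • s) := by
    intro a b r s y x
    have : ⟪δ y, (J a).adjoint (J b ((m r).adjoint (m s (δ x))))⟫_ℂ = 
        ⟪(J b).adjoint (J a (δ y)), (m r).adjoint (m s (δ x))⟫_ℂ := by
      rw [ContinuousLinearMap.adjoint_inner_right, ContinuousLinearMap.adjoint_inner_left]
    rw [this, hexp]
    refine tsum_congr fun z => ?_
    rw [hM, hA']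
  have hcomm : ∀ a b r s, ((m r).adjoint.comp (m s)).comp ((J a).adjoint.comp (J b)) =
      ((J a).adjoint.comp (J b)).comp ((m r).adjoint.comp (m s)) := by
    intro a b r s
    apply hext
    intro y x
    simp only [ContinuousLinearMap.comp_apply]
    rw [hMA, hAM]
    let e : N ≃ N := ((Equiv.inv N).trans (Equiv.mulLeft x)).trans (Equiv.mulRight y)
    rw [← e.tsum_eq]
    refine tsum_congr fun z => ?_
    have : e z = x * z⁻¹ * y := rfl
    rw [this]
    rw [mul_comm]
    congr 3 <;> group
  have key : ∀ r s, ⟪m r (δ 1), m s ((J r).adjoint (J s (δ 1)))⟫_ℂ =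
      ∑' v : N, K1 r (v • s) * K2 r (v • s) := by
    intro r s
    rw [← ContinuousLinearMap.adjoint_inner_right, hMA, ← (Equiv.inv N).tsum_eq]
    refine tsum_congr fun z => ?_
    simp [mul_comm]
  have hfin : ∀ R : Finset I, (Matrix.of fun r s : R => 
      ∑' v : N, K1 r (v • (s : I)) * K2 r (v • (s : I))).PosSemidef := by
    intro R
    have := cs_commSchur (R := R) (fun r => J r) (fun r => m r)
      (fun a b r s v => DFunLike.congr_fun (hcomm a b r s) v) (δ 1)
    simp only [key] at this
    exact this
  refine ⟨?_, fun x => ?_⟩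
  · ext a b
    have := (hfin {a, b}).isHermitian.apply ⟨a, by simp⟩ ⟨b, by simp⟩
    simpa using this
  · have := (Matrix.posSemidef_iff_dotProduct_mulVec.mp (hfin x.support)).2 (fun i => x i)
    refine this.trans_eq ?_
    simp only [dotProduct, Matrix.mulVec, Matrix.of_apply, Finsupp.sum, Pi.star_apply]
    rw [Finset.sum_coe_sort x.support (fun i => star (x i) * ∑ j : x.support, (∑' v : N, K1 i (v • (j : I)) * K2 i (v • (j : I))) * x j)]
    refine Finset.sum_congr rfl fun i _ => ?_
    rw [Finset.sum_coe_sort x.support (fun j => (∑' v : N, K1 i (v • j) * K2 i (v • j)) * x j), Finset.mul_sum]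
    simp only [mul_assoc]
end P5


section P6
/-- real pairing -/
noncomputable def csPair {T : Type} (ψ : T → ℂ) : (T →₀ ℂ) →ₗ[ℝ] ℝ :=
  Complex.reLm.comp ((Finsupp.linearCombination ℂ ψ).restrictScalars ℝ)

lemma csPair_apply {T : Type} (ψ : T → ℂ) (x : T →₀ ℂ) :
    csPair ψ x = (Finsupp.linearCombination ℂ ψ x).re := rfl

lemma csPair_single {T : Type} (ψ : T → ℂ) (p : T) (c : ℂ) :
    csPair ψ (Finsupp.single p c) = (c * ψ p).re := by
  rw [csPair_apply, Finsupp.linearCombination_single, smul_eq_mul]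

lemma cs_HB {T : Type} (Ps : Set (T → ℂ)) (D : Set T) (φ0 : T → ℂ)
    (hpos : ∀ x : T →₀ ℂ, (x.support : Set T) ⊆ D → (∀ ψ ∈ Ps, 0 ≤ csPair ψ x) → 0 ≤ csPair φ0 x)
    (hcof : ∀ p, ∃ u : T →₀ ℂ, (u.support : Set T) ⊆ D ∧ ∀ ψ ∈ Ps, ‖ψ p‖ ≤ csPair ψ u) :
    ∃ φ : T → ℂ, (∀ p ∈ D, φ p = φ0 p) ∧
      ∀ x : T →₀ ℂ, (∀ ψ ∈ Ps, 0 ≤ csPair ψ x) → 0 ≤ csPair φ x := by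
  classical
  let s : PointedCone ℝ (T →₀ ℂ) :=
    { carrier := {x | ∀ ψ ∈ Ps, 0 ≤ csPair ψ x}
      add_mem' := fun {a b} ha hb ψ hψ => by
        rw [map_add]; exact add_nonneg (ha ψ hψ) (hb ψ hψ)
      zero_mem' := fun ψ _ => by simp
      smul_mem' := fun c x hx ψ hψ => by
        have : csPair ψ (c • x) = (c : ℝ) * csPair ψ x := by
          change csPair ψ ((c : ℝ) • x) = _
          rw [map_smul, smul_eq_mul]
        rw [this]; exact mul_nonneg c.2 (hx ψ hψ) }
  let f : (T →₀ ℂ) →ₗ.[ℝ] ℝ :=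
    { domain := (Finsupp.supported ℂ ℂ D).restrictScalars ℝ
      toFun := (csPair φ0).domRestrict _ }
  have hs : ∀ x, x ∈ s ↔ ∀ ψ ∈ Ps, 0 ≤ csPair ψ x := fun x => Iff.rfl
  have hfd : ∀ x, x ∈ f.domain ↔ (x.support : Set T) ⊆ D := fun x => Iff.rfl
  have hf : ∀ x : f.domain, f x = csPair φ0 x := fun x => rfl
  obtain ⟨g, hg1, hg2⟩ := riesz_extension s f (fun x hx => by
      rw [hf]; exact hpos x ((hfd _).1 x.2) hx) (by
    intro y
    induction y using Finsupp.induction_linear with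
    | zero => exact ⟨0, by simp⟩
    | add a b ha hb =>
      obtain ⟨xa, ha⟩ := ha
      obtain ⟨xb, hb⟩ := hb
      refine ⟨xa + xb, ?_⟩
      have := s.add_mem ha hb
      convert this using 1
      push_cast; abel
    | single p c =>
      obtain ⟨u, hu, hu'⟩ := hcof p
      refine ⟨‖c‖ • ⟨u, (hfd _).2 hu⟩, ?_⟩
      rw [hs]
      intro ψ hψ
      change 0 ≤ csPair ψ (‖c‖ • u + _)
      rw [map_add, map_smul, csPair_single, smul_eq_mul]
      have h1 := Complex.abs_re_le_norm (c * ψ p)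
      rw [norm_mul] at h1
      have h2 := mul_le_mul_of_nonneg_left (hu' ψ hψ) (norm_nonneg c)
      have := neg_abs_le (c * ψ p).re
      linarith)
  refine ⟨fun p => ⟨g (Finsupp.single p 1), - g (Finsupp.single p Complex.I)⟩, ?_, ?_⟩
  · intro p hp
    have h : ∀ c : ℂ, g (Finsupp.single p c) = (c * φ0 p).re := by
      intro c
      have := hg1 ⟨Finsupp.single p c, (hfd _).2 (by
        refine (Finset.coe_subset.2 Finsupp.support_single_subset).trans ?_
        simpa using hp)⟩
      rw [hf] at this
      exact this.trans (csPair_single _ _ _)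
    apply Complex.ext
    · simp [h]
    · simp [h]
  · intro x hx
    have : csPair (fun p => (⟨g (Finsupp.single p 1), - g (Finsupp.single p Complex.I)⟩ : ℂ)) = g := by
      refine LinearMap.ext fun x => ?_
      induction x using Finsupp.induction_linear with
      | zero => simp
      | add a b ha hb => rw [map_add, map_add, ha, hb]
      | single p c =>
        rw [csPair_single]
        have e : Finsupp.single p c = c.re • Finsupp.single p (1:ℂ) + c.im • Finsupp.single p Complex.I := by
          rw [Finsupp.smul_single, Finsupp.smul_single, ← Finsupp.single_add]
          congr 1
          simp
        rw [e, map_add, map_smul, map_smul]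
        simp
    rw [this]
    exact hg2 x hx

/-- positive definite two by two matrix functions -/
def csPD {F : Type} [Group F] (ψ : Fin 2 × Fin 2 × F → ℂ) : Prop :=
  (Matrix.of fun a b : F × Fin 2 => ψ (a.2, b.2, a.1⁻¹ * b.1)).PosSemidef

lemma csPD_bound {F : Type} [Group F] (ψ : Fin 2 × Fin 2 × F → ℂ) (h : csPD ψ) (p) :
    ‖ψ p‖ ≤ (ψ (0,0,1)).re + (ψ (1,1,1)).re := by
  obtain ⟨E, _, _, _, k, hk, -⟩ := cs_kolmogorov _ h
  obtain ⟨i, j, w⟩ := p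
  have hn : ∀ a, ‖k a‖ ^ 2 = (ψ (a.2, a.2, 1)).re := by
    intro a
    have := hk a a
    rw [inner_self_eq_norm_sq_to_K] at this
    simp only [Matrix.of_apply, inv_mul_cancel] at this
    rw [← this]
    norm_cast
  have hle : ∀ a, ‖k a‖ ^ 2 ≤ (ψ (0,0,1)).re + (ψ (1,1,1)).re := by
    intro a
    have h0 := hn (1, 0)
    have h1 := hn (1, 1)
    have := hn a
    rw [this]
    rcases a with ⟨a, i⟩
    have h2 : 0 ≤ (ψ (0,0,1)).re := by rw [← h0]; positivity
    have h3 : 0 ≤ (ψ (1,1,1)).re := by rw [← h1]; positivity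
    fin_cases i
    · change (ψ (0,0,1)).re ≤ _; linarith
    · change (ψ (1,1,1)).re ≤ _; linarith
  have e : ψ (i, j, w) = ⟪k (1, i), k (w, j)⟫_ℂ := by rw [hk]; simp
  rw [e]
  have h1 := norm_inner_le_norm (𝕜 := ℂ) (k (1,i)) (k (w,j))
  have h2 := hle (1,i)
  have h3 := hle (w,j)
  nlinarith [sq_nonneg (‖k (1,i)‖ - ‖k (w,j)‖)]

lemma csPD_HB {F : Type} [Group F] (D : Set (Fin 2 × Fin 2 × F)) (φ0 : Fin 2 × Fin 2 × F → ℂ)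
    (h0 : (0,0,1) ∈ D) (h1 : (1,1,1) ∈ D)
    (hpos : ∀ x : (Fin 2 × Fin 2 × F) →₀ ℂ, (x.support : Set _) ⊆ D →
      (∀ ψ, csPD ψ → 0 ≤ csPair ψ x) → 0 ≤ csPair φ0 x) :
    ∃ φ : Fin 2 × Fin 2 × F → ℂ, csPD φ ∧ (∀ p ∈ D, φ p = φ0 p) := by
  classical
  obtain ⟨φ, hφ1, hφ2⟩ := cs_HB {ψ | csPD ψ} D φ0 hpos (by
    intro p
    refine ⟨Finsupp.single (0,0,1) 1 + Finsupp.single (1,1,1) 1, ?_, ?_⟩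
    · intro q hq
      have := Finsupp.support_add hq
      rcases Finset.mem_union.1 this with h | h
      · have := Finsupp.support_single_subset h
        simp at this; rw [this]; exact h0
      · have := Finsupp.support_single_subset h
        simp at this; rw [this]; exact h1
    · intro ψ hψ
      rw [map_add, csPair_single, csPair_single]
      simpa using csPD_bound ψ hψ p)
  refine ⟨φ, ⟨?_, ?_⟩, hφ1⟩
  · have key : ∀ i j w (c : ℂ), (c * φ (i,j,w)).re = (star c * φ (j,i,w⁻¹)).re := by
      intro i j w c
      have hz : ∀ ψ, csPD ψ → csPair ψ (Finsupp.single (i,j,w) c - Finsupp.single (j,i,w⁻¹) (star c)) = 0 := by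
        intro ψ hψ
        rw [map_sub, csPair_single, csPair_single]
        have := hψ.isHermitian.apply (1, i) (w, j)
        simp at this
        rw [← this]
        simp
      have a := hφ2 _ (fun ψ hψ => (hz ψ hψ).ge)
      have b := hφ2 (-(Finsupp.single (i,j,w) c - Finsupp.single (j,i,w⁻¹) (star c))) (fun ψ hψ => by
        rw [map_neg, hz ψ hψ, neg_zero])
      rw [map_neg] at b
      rw [map_sub, csPair_single, csPair_single] at a b
      linarith
    ext a b
    have e := key b.2 a.2 (b.1⁻¹ * a.1)
    simp only [mul_inv_rev, inv_inv] at e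
    rw [Matrix.conjTranspose_apply, Matrix.of_apply, Matrix.of_apply]
    have e1 := e 1
    have e2 := e Complex.I
    simp at e1 e2
    apply Complex.ext <;> simp [e1, e2]
  · intro y
    let X : ℂ → (Fin 2 × Fin 2 × F) →₀ ℂ := fun c =>
      y.sum fun a ya => y.sum fun b yb => Finsupp.single (a.2, b.2, a.1⁻¹ * b.1) (c * (star ya * yb))
    have hX : ∀ ψ c, csPair ψ (X c) = (c * y.sum fun a ya => y.sum fun b yb =>
        star ya * (Matrix.of fun a b : F × Fin 2 => ψ (a.2, b.2, a.1⁻¹ * b.1)) a b * yb).re := by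
      intro ψ c
      simp only [X, Finsupp.sum, map_sum, csPair_single, Finset.mul_sum, Complex.re_sum]
      refine Finset.sum_congr rfl fun a _ => Finset.sum_congr rfl fun b _ => ?_
      simp only [Matrix.of_apply]
      congr 1; ring
    have hp : ∀ c : ℂ, 0 ≤ c.re → 0 ≤ csPair φ (X c) := by
      intro c hc
      apply hφ2
      intro ψ hψ
      rw [hX]
      have := hψ.2 y
      obtain ⟨h1, h2⟩ := Complex.nonneg_iff.1 this
      rw [Complex.mul_re, ← h2, mul_zero, sub_zero]
      exact mul_nonneg hc h1
    have q1 := hp 1 (by simp)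
    have q2 := hp Complex.I (by simp)
    have q3 := hp (-Complex.I) (by simp)
    rw [hX] at q1 q2 q3
    rw [Complex.nonneg_iff]
    refine ⟨by simpa using q1, ?_⟩
    simp only [neg_mul, Complex.neg_re, Complex.I_mul_re, neg_neg] at q2 q3
    linarith
end P6


section P7
variable {H : Type} [NormedAddCommGroup H] [InnerProductSpace ℂ H]

lemma csOp_apply {G : Type} {Λ : Set G} {N : ℕ} (a : ↥Λ →₀ Matrix (Fin N) (Fin N) ℂ)
    (v : ↥Λ → H →L[ℂ] H) (x : PiLp 2 (fun _ : Fin N => H)) (i : Fin N) :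
    (sidonOp a v x) i = ∑ t ∈ a.support, ∑ j, (a t i j) • v t (x j) := by
  have : (sidonOp a v x) i = (∑ t ∈ a.support, ∑ j, (a t i j) •
    ((v t).comp (ContinuousLinearMap.proj (φ := fun _ : Fin N => H) j))) (fun j => x j) := rfl
  rw [this]
  simp [sum_apply]

lemma csOp_apply' {G : Type} {Λ : Set G} {N : ℕ} (a : ↥Λ →₀ Matrix (Fin N) (Fin N) ℂ)
    (v : ↥Λ → H →L[ℂ] H) (x : PiLp 2 (fun _ : Fin N => H)) (i : Fin N) (s : Finset Λ)
    (hs : a.support ⊆ s) :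
    (sidonOp a v x) i = ∑ t ∈ s, ∑ j, (a t i j) • v t (x j) := by
  rw [csOp_apply]
  refine Finset.sum_subset hs fun t _ ht => ?_
  rw [Finsupp.notMem_support_iff.1 ht]
  simp

/-- scalar form -/
noncomputable def csForm {G : Type} {Λ : Set G} {N : ℕ} (v : ↥Λ → H →L[ℂ] H)
    (y x : Fin N → H) (a : ↥Λ →₀ Matrix (Fin N) (Fin N) ℂ) : ℂ :=
  a.sum fun t M => ∑ i, ∑ j, M i j * ⟪y i, v t (x j)⟫_ℂ

lemma csForm_eq {G : Type} {Λ : Set G} {N : ℕ} (v : ↥Λ → H →L[ℂ] H)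
    (y x : PiLp 2 (fun _ : Fin N => H)) (a : ↥Λ →₀ Matrix (Fin N) (Fin N) ℂ) :
    ⟪y, sidonOp a v x⟫_ℂ = csForm v (fun i => y i) (fun i => x i) a := by
  rw [PiLp.inner_apply]
  simp only [csOp_apply, inner_sum, inner_smul_right, csForm, Finsupp.sum]
  rw [Finset.sum_comm]

lemma csForm_add {G : Type} {Λ : Set G} {N : ℕ} (v : ↥Λ → H →L[ℂ] H)
    (y x : Fin N → H) (a b : ↥Λ →₀ Matrix (Fin N) (Fin N) ℂ) :
    csForm v y x (a + b) = csForm v y x a + csForm v y x b := by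
  classical
  unfold csForm
  rw [Finsupp.sum_add_index']
  · simp
  · intro t M M'
    simp [add_mul, Finset.sum_add_distrib]

lemma csForm_single {G : Type} {Λ : Set G} {N : ℕ} (v : ↥Λ → H →L[ℂ] H)
    (y x : Fin N → H) (t : Λ) (M : Matrix (Fin N) (Fin N) ℂ) :
    csForm v y x (Finsupp.single t M) = ∑ i, ∑ j, M i j * ⟪y i, v t (x j)⟫_ℂ := by
  unfold csForm
  rw [Finsupp.sum_single_index]
  simp

/-- amplification -/
noncomputable def csAm {N : ℕ} (M : Matrix (Fin N) (Fin N) ℂ) :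
    PiLp 2 (fun _ : Fin N => H) →L[ℂ] PiLp 2 (fun _ : Fin N => H) :=
  ((PiLp.continuousLinearEquiv 2 ℂ (fun _ : Fin N => H)).symm : (Fin N → H) →L[ℂ] _).comp
    (ContinuousLinearMap.pi fun i => ∑ j, M i j • (PiLp.proj 2 (fun _ : Fin N => H) j))

lemma csAm_apply {N : ℕ} (M : Matrix (Fin N) (Fin N) ℂ) (x : PiLp 2 (fun _ : Fin N => H)) (i) :
    (csAm M x) i = ∑ j, M i j • x j := by
  have : (csAm M x) i = (∑ j, M i j • (PiLp.proj 2 (fun _ : Fin N => H) (𝕜 := ℂ) j)) x := rfl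
  rw [this]
  simp [sum_apply]

lemma csAm_mul {N : ℕ} (M M' : Matrix (Fin N) (Fin N) ℂ) (x : PiLp 2 (fun _ : Fin N => H)) :
    csAm (M * M') x = csAm M (csAm M' x) := by
  ext i
  simp only [csAm_apply, Matrix.mul_apply, Finset.sum_smul, Finset.smul_sum, smul_smul]
  rw [Finset.sum_comm]

lemma csAm_one {N : ℕ} (x : PiLp 2 (fun _ : Fin N => H)) :
    csAm (1 : Matrix (Fin N) (Fin N) ℂ) x = x := by
  ext i
  simp [csAm_apply, Matrix.one_apply]

lemma csAm_inner {N : ℕ} (M : Matrix (Fin N) (Fin N) ℂ) (x y : PiLp 2 (fun _ : Fin N => H)) :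
    ⟪y, csAm M x⟫_ℂ = ∑ i, ∑ j, M i j * ⟪y i, x j⟫_ℂ := by
  rw [PiLp.inner_apply]
  simp only [csAm_apply, inner_sum, inner_smul_right]

lemma csAm_adj {N : ℕ} (M : Matrix (Fin N) (Fin N) ℂ) (x y : PiLp 2 (fun _ : Fin N => H)) :
    ⟪csAm M y, x⟫_ℂ = ⟪y, csAm M.conjTranspose x⟫_ℂ := by
  rw [csAm_inner, ← inner_conj_symm, csAm_inner]
  simp only [map_sum, map_mul, inner_conj_symm]
  rw [Finset.sum_comm]
  rfl

lemma csOp_conj {G : Type} {Λ : Set G} {N : ℕ} (v : ↥Λ → H →L[ℂ] H)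
    (x : PiLp 2 (fun _ : Fin N => H)) (a b : ↥Λ →₀ Matrix (Fin N) (Fin N) ℂ)
    (L R : Matrix (Fin N) (Fin N) ℂ) (h : ∀ t, b t = L * a t * R) :
    sidonOp b v x = csAm L (sidonOp a v (csAm R x)) := by
  ext i
  have hs : b.support ⊆ a.support := by
    intro t ht
    rw [Finsupp.mem_support_iff] at ht ⊢
    intro h0
    apply ht
    rw [h, h0]; simp
  rw [csOp_apply' b v x i _ hs, csAm_apply]
  simp only [csOp_apply, csAm_apply, map_sum, map_smul, Finset.smul_sum, smul_smul]
  refine Eq.trans ?_ Finset.sum_comm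
  refine Finset.sum_congr rfl fun t _ => ?_
  simp only [h, Matrix.mul_apply, Finset.sum_mul, Finset.sum_smul, mul_assoc]
  rw [Finset.sum_comm]
  refine Eq.trans (Finset.sum_congr rfl fun k _ => Finset.sum_comm) ?_
  rw [Finset.sum_comm]

lemma cs_norm_le_two {L : Type} [NormedAddCommGroup L] [InnerProductSpace ℂ L] (T : L →L[ℂ] L)
    (h : ∀ a b, 0 ≤ ‖a‖ ^ 2 + ‖b‖ ^ 2 + (⟪b, T a⟫_ℂ).re) : ‖T‖ ≤ 2 := by
  refine T.opNorm_le_bound (by norm_num) fun a => ?_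
  by_cases h1 : ‖T a‖ = 0
  · rw [h1]; positivity
  by_cases h2 : ‖a‖ = 0
  · rw [norm_eq_zero] at h2; simp [h2]
  have := h a ((-(‖a‖ / ‖T a‖) : ℝ) • T a)
  rw [norm_smul, inner_smul_left_eq_smul, Complex.real_smul, inner_self_eq_norm_sq_to_K] at this
  have e : (((-(‖a‖ / ‖T a‖) : ℝ) : ℂ) * ((‖T a‖ : ℂ)) ^ 2).re = -(‖a‖ * ‖T a‖) := by
    norm_cast
    field_simp
  simp only [Complex.coe_algebraMap] at this
  rw [e, norm_neg, norm_div, norm_norm, norm_norm, div_mul_cancel₀ _ h1] at this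
  have h3 : 0 < ‖a‖ := lt_of_le_of_ne (norm_nonneg _) (Ne.symm h2)
  nlinarith
end P7


section P8
open scoped MatrixOrder in
lemma cs_factor {n : ℕ} (A : Matrix (Fin n) (Fin n) ℂ)
    (hA : ∀ v : PiLp 2 (fun _ : Fin n => ℂ), 0 ≤ (⟪v, csAm A v⟫_ℂ).re) (δ : ℝ) (hδ : 0 < δ) :
    ∃ R R' : Matrix (Fin n) (Fin n) ℂ, R * R' = 1 ∧ R' * R = 1 ∧
      ∀ (H : Type) [NormedAddCommGroup H] [InnerProductSpace ℂ H] (v : PiLp 2 (fun _ : Fin n => H)),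
        ‖csAm R v‖ ^ 2 = (⟪v, csAm A v⟫_ℂ).re + δ * ‖v‖ ^ 2 := by
  let Ah : Matrix (Fin n) (Fin n) ℂ := (1/2 : ℂ) • (A + A.conjTranspose)
  have hherm : Ah.IsHermitian := by
    simp [Ah, Matrix.IsHermitian, add_comm]
  have key : ∀ (H : Type) [NormedAddCommGroup H] [InnerProductSpace ℂ H]
      (v : PiLp 2 (fun _ : Fin n => H)), (⟪v, csAm Ah v⟫_ℂ).re = (⟪v, csAm A v⟫_ℂ).re := by
    intro H _ _ v
    have e : ⟪v, csAm Ah v⟫_ℂ = (1/2 : ℂ) * (⟪v, csAm A v⟫_ℂ + ⟪v, csAm A.conjTranspose v⟫_ℂ) := by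
      simp only [csAm_inner, Ah, Matrix.smul_apply, Matrix.add_apply, smul_eq_mul]
      rw [← Finset.sum_add_distrib, Finset.mul_sum]
      refine Finset.sum_congr rfl fun i _ => ?_
      rw [← Finset.sum_add_distrib, Finset.mul_sum]
      refine Finset.sum_congr rfl fun j _ => ?_
      ring
    have e2 : (⟪v, csAm A.conjTranspose v⟫_ℂ).re = (⟪v, csAm A v⟫_ℂ).re := by
      rw [← csAm_adj, ← inner_conj_symm, Complex.conj_re]
    rw [e]
    have : (1/2 : ℂ) = ((1/2 : ℝ) : ℂ) := by norm_num
    rw [this, Complex.re_ofReal_mul, Complex.add_re, e2]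
    ring
  have hps : Ah.PosSemidef := by
    rw [Matrix.posSemidef_iff_dotProduct_mulVec]
    refine ⟨hherm, fun x => ?_⟩
    have h1 := hA (WithLp.toLp 2 x)
    rw [← key, csAm_inner] at h1
    have e : star x ⬝ᵥ Ah.mulVec x = ∑ i, ∑ j, Ah i j * ⟪x i, x j⟫_ℂ := by
      simp only [dotProduct, Matrix.mulVec, Finset.mul_sum, Pi.star_apply]
      refine Finset.sum_congr rfl fun i _ => Finset.sum_congr rfl fun j _ => ?_
      simp
      ring
    rw [e, Complex.nonneg_iff]
    refine ⟨h1, ?_⟩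
    rw [← e]
    have := hherm.im_star_dotProduct_mulVec_self x
    exact this.symm
  have hpd : (Ah + (δ : ℂ) • (1 : Matrix (Fin n) (Fin n) ℂ)).PosDef := by
    refine Matrix.PosDef.posSemidef_add hps ?_
    refine Matrix.PosDef.smul Matrix.PosDef.one ?_
    exact_mod_cast hδ
  obtain ⟨R, hR⟩ := CStarAlgebra.nonneg_iff_eq_star_mul_self.mp hpd.posSemidef.nonneg
  have hu : IsUnit R := by
    have := hpd.isUnit
    rw [hR, Matrix.isUnit_iff_isUnit_det, Matrix.det_mul] at this
    rw [Matrix.isUnit_iff_isUnit_det]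
    exact isUnit_of_mul_isUnit_right this
  rw [Matrix.isUnit_iff_isUnit_det] at hu
  refine ⟨R, R⁻¹, Matrix.mul_nonsing_inv _ hu, Matrix.nonsing_inv_mul _ hu, ?_⟩
  intro H _ _ v
  have e1 : ⟪csAm R v, csAm R v⟫_ℂ = ⟪v, csAm Ah v⟫_ℂ + δ * ⟪v, v⟫_ℂ := by
    rw [csAm_adj, ← csAm_mul, ← Matrix.star_eq_conjTranspose, ← hR, csAm_inner, csAm_inner,
      PiLp.inner_apply, Finset.mul_sum, ← Finset.sum_add_distrib]
    refine Finset.sum_congr rfl fun i _ => ?_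
    simp [add_mul, Finset.sum_add_distrib, Matrix.one_apply]
  rw [← key]
  have e2 := congrArg Complex.re e1
  rw [inner_self_eq_norm_sq_to_K, inner_self_eq_norm_sq_to_K, Complex.add_re,
    Complex.re_ofReal_mul] at e2
  norm_cast at e2

lemma cs_matrix {G : Type} [Group G] (Λ : Set G) (C : ℝ) (hC : 1 ≤ C) (hΛ : IsCompletelySidon Λ C)
    {n : ℕ} (A B : Matrix (Fin n) (Fin n) ℂ) (X : ↥Λ →₀ Matrix (Fin n) (Fin n) ℂ)
    (hpos : ∀ (H' : Type) [NormedAddCommGroup H'] [InnerProductSpace ℂ H'] [CompleteSpace H']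
        (π : G →* unitary (H' →L[ℂ] H')) (v0 v1 : PiLp 2 (fun _ : Fin n => H')),
        0 ≤ (⟪v0, csAm A v0⟫_ℂ + ⟪v1, csAm B v1⟫_ℂ +
          ⟪v1, sidonOp X (fun t => ((π (t : G) : unitary (H' →L[ℂ] H')) : H' →L[ℂ] H')) v0⟫_ℂ).re)
    (K : Type) [NormedAddCommGroup K] [InnerProductSpace ℂ K] [CompleteSpace K]
    (u : ↥Λ → unitary (K →L[ℂ] K)) (v0 v1 : PiLp 2 (fun _ : Fin n => K)) :
    0 ≤ (C * ⟪v0, csAm A v0⟫_ℂ + C * ⟪v1, csAm B v1⟫_ℂ +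
          ⟪v1, sidonOp X (fun t => ((u t : unitary (K →L[ℂ] K)) : K →L[ℂ] K)) v0⟫_ℂ).re := by
  have hA : ∀ v : PiLp 2 (fun _ : Fin n => ℂ), 0 ≤ (⟪v, csAm A v⟫_ℂ).re := fun v => by
    simpa using hpos ℂ 1 v 0
  have hB : ∀ v : PiLp 2 (fun _ : Fin n => ℂ), 0 ≤ (⟪v, csAm B v⟫_ℂ).re := fun v => by
    simpa using hpos ℂ 1 0 v
  suffices h : ∀ δ : ℝ, 0 < δ → 0 ≤ (C * ⟪v0, csAm A v0⟫_ℂ + C * ⟪v1, csAm B v1⟫_ℂ +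
          ⟪v1, sidonOp X (fun t => ((u t : unitary (K →L[ℂ] K)) : K →L[ℂ] K)) v0⟫_ℂ).re +
          δ * (C * (‖v0‖ ^ 2 + ‖v1‖ ^ 2)) by
    by_contra hneg
    push Not at hneg
    set r := (C * ⟪v0, csAm A v0⟫_ℂ + C * ⟪v1, csAm B v1⟫_ℂ +
          ⟪v1, sidonOp X (fun t => ((u t : unitary (K →L[ℂ] K)) : K →L[ℂ] K)) v0⟫_ℂ).re
    set Q := C * (‖v0‖ ^ 2 + ‖v1‖ ^ 2) with hQ
    have hQ0 : 0 ≤ Q := by positivity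
    have := h (-r / (2 * (Q + 1))) (div_pos (by linarith) (by positivity))
    have e : -r / (2 * (Q + 1)) * Q ≤ -r / 2 := by
      rw [div_mul_eq_mul_div, div_le_div_iff₀ (by positivity) (by norm_num)]
      nlinarith
    linarith
  intro δ hδ
  obtain ⟨R, R', hR1, hR2, hR⟩ := cs_factor A hA δ hδ
  obtain ⟨L, L', hL1, hL2, hL⟩ := cs_factor B hB δ hδ
  let Y : ↥Λ →₀ Matrix (Fin n) (Fin n) ℂ :=
    X.mapRange (fun M => L'.conjTranspose * M * R') (by simp)
  have hY : ∀ t, Y t = L'.conjTranspose * X t * R' := fun t => by simp [Y]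
  have hXY : ∀ t, X t = L.conjTranspose * Y t * R := by
    intro t
    have hLL : L.conjTranspose * L'.conjTranspose = 1 := by
      rw [← Matrix.conjTranspose_mul, hL2, Matrix.conjTranspose_one]
    calc X t = 1 * X t * 1 := by simp
      _ = (L.conjTranspose * L'.conjTranspose) * X t * (R' * R) := by rw [hLL, hR2]
      _ = _ := by rw [hY]; simp only [Matrix.mul_assoc]
  have hbound := hΛ n Y 2 (by norm_num) (fun H' _ _ _ π => by
    apply cs_norm_le_two
    intro a b
    have := hpos H' π (csAm R' a) (csAm L' b)
    have e1 := hR H' (csAm R' a)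
    have e2 := hL H' (csAm L' b)
    rw [← csAm_mul, hR1, csAm_one] at e1
    rw [← csAm_mul, hL1, csAm_one] at e2
    rw [csOp_conj _ a X Y _ _ hY, ← csAm_adj]
    rw [Complex.add_re, Complex.add_re] at this
    have p1 : 0 ≤ δ * ‖csAm R' a‖ ^ 2 := by positivity
    have p2 : 0 ≤ δ * ‖csAm L' b‖ ^ 2 := by positivity
    linarith) K u
  rw [csOp_conj _ v0 Y X _ _ hXY, ← csAm_adj]
  have e1 := hR K v0
  have e2 := hL K v1
  set T := sidonOp Y (fun t => ((u t : unitary (K →L[ℂ] K)) : K →L[ℂ] K))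
  have n1 : ‖⟪csAm L v1, T (csAm R v0)⟫_ℂ‖ ≤ ‖csAm L v1‖ * (C * 2 * ‖csAm R v0‖) :=
    (norm_inner_le_norm _ _).trans
      (mul_le_mul_of_nonneg_left (T.le_of_opNorm_le hbound _) (norm_nonneg _))
  have n2 := Complex.abs_re_le_norm ⟪csAm L v1, T (csAm R v0)⟫_ℂ
  have n3 := neg_abs_le (⟪csAm L v1, T (csAm R v0)⟫_ℂ).re
  rw [Complex.add_re, Complex.add_re, Complex.re_ofReal_mul, Complex.re_ofReal_mul]
  have n4 : 0 ≤ C * (‖csAm L v1‖ - ‖csAm R v0‖) ^ 2 := by positivity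
  nlinarith
end P8


section P9
/-- twisted coefficient is positive definite -/
lemma cs_coefPD {F G : Type} [Group F] [Group G] (q : F →* G) {n : ℕ} (p : F →* Equiv.Perm (Fin n))
    {H : Type} [NormedAddCommGroup H] [InnerProductSpace ℂ H] [CompleteSpace H]
    (π : G →* unitary (H →L[ℂ] H)) (v : Fin 2 → Fin n → H) :
    csPD (fun a : Fin 2 × Fin 2 × F => ∑ c, ⟪v a.1 c,
      (π (q a.2.2) : H →L[ℂ] H) (v a.2.1 ((p a.2.2)⁻¹ c))⟫_ℂ) := by
  refine cs_gram_posSemidef (fun a : F × Fin 2 => (WithLp.toLp 2 fun c =>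
    (π (q a.1) : H →L[ℂ] H) (v a.2 ((p a.1)⁻¹ c)) : PiLp 2 (fun _ : Fin n => H))) _ ?_
  rintro ⟨w, i⟩ ⟨w', j⟩
  rw [PiLp.inner_apply, Matrix.of_apply, ← Equiv.sum_comp (p w)]
  refine Finset.sum_congr rfl fun c _ => ?_
  simp only [map_mul, map_inv, mul_inv_rev, inv_inv, Equiv.Perm.mul_apply]
  have hcc : (p w)⁻¹ (p w c) = c := (p w).symm_apply_apply c
  have : ∀ x y : H, ⟪(π (q w) : H →L[ℂ] H) x, y⟫_ℂ = ⟪x, (((π (q w))⁻¹ : unitary (H →L[ℂ] H)) : H →L[ℂ] H) y⟫_ℂ := by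
    intro x y
    rw [← ContinuousLinearMap.adjoint_inner_right, ← ContinuousLinearMap.star_eq_adjoint]
    rfl
  rw [this, hcc]
  rfl

lemma cs_perm_unitary {n : ℕ} (σ : Equiv.Perm (Fin n)) :
    ∃ u : unitary (EuclideanSpace ℂ (Fin n) →L[ℂ] EuclideanSpace ℂ (Fin n)),
      ∀ b, (u : EuclideanSpace ℂ (Fin n) →L[ℂ] EuclideanSpace ℂ (Fin n)) (EuclideanSpace.single b 1) =
        EuclideanSpace.single (σ b) 1 := by
  refine ⟨Unitary.linearIsometryEquiv.symm (LinearIsometryEquiv.piLpCongrLeft 2 ℂ ℂ σ), fun b => ?_⟩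
  simp [EuclideanSpace.single]

lemma cs_eu_orth {n : ℕ} {i k : Fin n} (h : i ≠ k) :
    ⟪EuclideanSpace.single i (1:ℂ), EuclideanSpace.single k (1:ℂ)⟫_ℂ = 0 := by
  simp [EuclideanSpace.inner_single_left, h]

set_option maxHeartbeats 2000000 in
open Classical in
lemma cs_pos {G : Type} [Group G] (Λ : Set G) (C : ℝ) (hC : 1 ≤ C) (hΛ : IsCompletelySidon Λ C)
    (q : FreeGroup G →* G) (hq : ∀ g, q (FreeGroup.of g) = g)
    (x : (Fin 2 × Fin 2 × FreeGroup G) →₀ ℂ)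
    (hx : ∀ a ∈ x.support, (a.1 = a.2.1 ∧ q a.2.2 = 1) ∨ (a.1 = 1 ∧ a.2.1 = 0 ∧ q a.2.2 ∈ Λ))
    (hP : ∀ ψ, csPD ψ → 0 ≤ csPair ψ x) :
    0 ≤ csPair (fun a => if a.1 = a.2.1 then (if a.2.2 = 1 then (C : ℂ) else 0) else
      (if a.2.2 = FreeGroup.of (q a.2.2) then 1 else 0)) x := by
  obtain ⟨n, hn, p, hp⟩ := cs_resfin ((x.support.image fun a => a.2.2) ∪
    (x.support.image fun a => (FreeGroup.of (q a.2.2))⁻¹ * a.2.2))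
  have hp1 : ∀ a ∈ x.support, a.2.2 ≠ 1 → ∀ i, p a.2.2 i ≠ i := fun a ha h =>
    hp _ (Finset.mem_union_left _ (Finset.mem_image_of_mem _ ha)) h
  have hp2 : ∀ a ∈ x.support, a.2.2 ≠ FreeGroup.of (q a.2.2) → ∀ i,
      p a.2.2 i ≠ p (FreeGroup.of (q a.2.2)) i := fun a ha h i hi => by
    refine hp _ (Finset.mem_union_right _ (Finset.mem_image_of_mem
      (fun a : Fin 2 × Fin 2 × FreeGroup G => (FreeGroup.of (q a.2.2))⁻¹ * a.2.2) ha)) ?_ i ?_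
    · intro h'; exact h (inv_mul_eq_one.1 h').symm
    · simp [hi]
  let lam : FreeGroup G → Matrix (Fin n) (Fin n) ℂ := fun w =>
    Matrix.of fun a b => if (p w)⁻¹ a = b then 1 else 0
  let A : Matrix (Fin n) (Fin n) ℂ := ∑ a ∈ x.support, if a.1 = 0 ∧ a.2.1 = 0 then x a • lam a.2.2 else 0
  let B : Matrix (Fin n) (Fin n) ℂ := ∑ a ∈ x.support, if a.1 = 1 ∧ a.2.1 = 1 then x a • lam a.2.2 else 0
  let X : ↥Λ →₀ Matrix (Fin n) (Fin n) ℂ := ∑ a ∈ x.support,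
    if h : (a.1 = 1 ∧ a.2.1 = 0) ∧ q a.2.2 ∈ Λ then Finsupp.single ⟨q a.2.2, h.2⟩ (x a • lam a.2.2) else 0
  -- expansions
  have hlam : ∀ (w : FreeGroup G) (c : ℂ) (f : Fin n → Fin n → ℂ),
      ∑ i, ∑ j, (c • lam w) i j * f i j = c * ∑ i, f i ((p w)⁻¹ i) := by
    intro w c f
    rw [Finset.mul_sum]
    refine Finset.sum_congr rfl fun i _ => ?_
    simp [lam]
  have hmat : ∀ (P : Fin 2 × Fin 2 × FreeGroup G → Prop) [DecidablePred P] (f : Fin n → Fin n → ℂ),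
      ∑ i, ∑ j, (∑ a ∈ x.support, if P a then x a • lam a.2.2 else 0) i j * f i j =
        ∑ a ∈ x.support, if P a then x a * ∑ i, f i ((p a.2.2)⁻¹ i) else 0 := by
    intro P _ f
    simp only [Matrix.sum_apply, Finset.sum_mul]
    rw [Finset.sum_congr rfl fun i _ => Finset.sum_comm, Finset.sum_comm]
    refine Finset.sum_congr rfl fun a _ => ?_
    split_ifs with h
    · exact hlam _ _ _
    · simp
  have hfs : ∀ {K : Type} [NormedAddCommGroup K] [InnerProductSpace ℂ K]
      (v : ↥Λ → K →L[ℂ] K) (y z : Fin n → K) (s : Finset (Fin 2 × Fin 2 × FreeGroup G))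
      (g : Fin 2 × Fin 2 × FreeGroup G → ↥Λ →₀ Matrix (Fin n) (Fin n) ℂ),
      csForm v y z (∑ a ∈ s, g a) = ∑ a ∈ s, csForm v y z (g a) := by
    intro K _ _ v y z s g
    let fh : (↥Λ →₀ Matrix (Fin n) (Fin n) ℂ) →+ ℂ :=
      AddMonoidHom.mk' (csForm v y z) (csForm_add v y z)
    exact map_sum fh g s
  have hXf : ∀ {K : Type} [NormedAddCommGroup K] [InnerProductSpace ℂ K]
      (v : G → K →L[ℂ] K) (y z : Fin n → K),
      csForm (fun t : Λ => v t) y z X = ∑ a ∈ x.support, if (a.1 = 1 ∧ a.2.1 = 0) ∧ q a.2.2 ∈ Λ then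
        x a * ∑ i, ⟪y i, v (q a.2.2) (z ((p a.2.2)⁻¹ i))⟫_ℂ else 0 := by
    intro K _ _ v y z
    rw [hfs]
    refine Finset.sum_congr rfl fun a _ => ?_
    split_ifs with h
    · rw [csForm_single]
      exact hlam _ _ (fun i j => ⟪y i, v (q a.2.2) (z j)⟫_ℂ)
    · simp [csForm]
  have main := cs_matrix Λ C hC hΛ A B X (by
    intro H' _ _ _ π v0 v1
    have h1 := hP _ (cs_coefPD q p π (fun i => if i = 0 then fun c => v0 c else fun c => v1 c))
    refine h1.trans_eq ?_
    rw [csPair_apply, Finsupp.linearCombination_apply, Finsupp.sum]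
    congr 1
    rw [csAm_inner, csAm_inner, csForm_eq, hmat, hmat, hXf (fun t => (π t : H' →L[ℂ] H')),
      ← Finset.sum_add_distrib, ← Finset.sum_add_distrib]
    refine Finset.sum_congr rfl fun a ha => ?_
    have := hx a ha
    rcases a with ⟨i, j, w⟩
    simp only at this
    fin_cases i <;> fin_cases j <;> simp_all)
    (EuclideanSpace ℂ (Fin n)) (fun t => (cs_perm_unitary (p (FreeGroup.of (t : G)))).choose)
    (WithLp.toLp 2 fun i => EuclideanSpace.single i 1) (WithLp.toLp 2 fun i => EuclideanSpace.single i 1)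
  have hu := fun t : G => (cs_perm_unitary (p (FreeGroup.of (t : G)))).choose_spec
  rw [csAm_inner, csAm_inner, csForm_eq, hmat, hmat, hXf (fun t : G =>
    ((cs_perm_unitary (p (FreeGroup.of (t : G)))).choose : EuclideanSpace ℂ (Fin n) →L[ℂ] EuclideanSpace ℂ (Fin n))),
      Finset.mul_sum, Finset.mul_sum, ← Finset.sum_add_distrib, ← Finset.sum_add_distrib] at main
  have hn' : (0 : ℝ) < n := by exact_mod_cast Nat.pos_of_ne_zero hn
  refine nonneg_of_mul_nonneg_right (main.trans_eq ?_) hn'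
  rw [csPair_apply, Finsupp.linearCombination_apply, Finsupp.sum, ← Complex.re_ofReal_mul, Finset.mul_sum]
  congr 1
  refine Finset.sum_congr rfl fun a ha => ?_
  have hxa := hx a ha
  have s1 : ∑ i : Fin n, ⟪EuclideanSpace.single i (1:ℂ), EuclideanSpace.single ((p a.2.2)⁻¹ i) (1:ℂ)⟫_ℂ
      = if a.2.2 = 1 then (n : ℂ) else 0 := by
    split_ifs with h
    · simp [h]
    · refine Finset.sum_eq_zero fun i _ => ?_
      have := hp1 a ha h ((p a.2.2)⁻¹ i)
      rw [show p a.2.2 ((p a.2.2)⁻¹ i) = i from (p a.2.2).apply_symm_apply i] at this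
      exact cs_eu_orth this
  have s2 : ∑ i : Fin n, ⟪EuclideanSpace.single i (1:ℂ), EuclideanSpace.single
      (p (FreeGroup.of (q a.2.2)) ((p a.2.2)⁻¹ i)) (1:ℂ)⟫_ℂ
      = if a.2.2 = FreeGroup.of (q a.2.2) then (n : ℂ) else 0 := by
    split_ifs with h
    · rw [← h]; simp
    · refine Finset.sum_eq_zero fun i _ => ?_
      have := hp2 a ha h ((p a.2.2)⁻¹ i)
      rw [show p a.2.2 ((p a.2.2)⁻¹ i) = i from (p a.2.2).apply_symm_apply i] at this
      exact cs_eu_orth this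
  simp only [hu, s1, s2]
  rcases a with ⟨i, j, w⟩
  simp only at hxa
  fin_cases i <;> fin_cases j <;> simp at hxa ⊢
  · split_ifs <;> ring
  · simp [hxa]; split_ifs <;> ring
  · split_ifs <;> ring
end P9


section P10
open Classical in
lemma cs_A {G : Type} [Group G] (Λ : Set G) (C : ℝ) (hC : 1 ≤ C) (hΛ : IsCompletelySidon Λ C)
    (q : FreeGroup G →* G) (hq : ∀ g, q (FreeGroup.of g) = g) :
    ∃ φ : Fin 2 × Fin 2 × FreeGroup G → ℂ, csPD φ ∧
      (∀ i w, q w = 1 → φ (i, i, w) = if w = 1 then (C : ℂ) else 0) ∧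
      (∀ w, q w ∈ Λ → φ (1, 0, w) = if w = FreeGroup.of (q w) then 1 else 0) := by
  obtain ⟨φ, h1, h2⟩ := csPD_HB
    {a : Fin 2 × Fin 2 × FreeGroup G | (a.1 = a.2.1 ∧ q a.2.2 = 1) ∨ (a.1 = 1 ∧ a.2.1 = 0 ∧ q a.2.2 ∈ Λ)}
    (fun a => if a.1 = a.2.1 then (if a.2.2 = 1 then (C : ℂ) else 0) else
      (if a.2.2 = FreeGroup.of (q a.2.2) then 1 else 0)) (by simp) (by simp)
    (fun x hx hP => cs_pos Λ C hC hΛ q hq x (fun a ha => hx ha) hP)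
  refine ⟨φ, h1, fun i w hw => ?_, fun w hw => ?_⟩
  · rw [h2 (i, i, w) (Or.inl ⟨rfl, hw⟩)]; simp
  · rw [h2 (1, 0, w) (Or.inr ⟨rfl, rfl, hw⟩)]; simp

lemma cs_eqPD {I J : Type} [DecidableEq J] (e : I → J) :
    (Matrix.of fun a b : I => if e a = e b then (1:ℂ) else 0).PosSemidef := by
  refine cs_gram_posSemidef (fun a => (lp.single 2 (e a) (1:ℂ) : lp (fun _ : J => ℂ) 2)) _ ?_
  intro a b
  rw [lp.inner_single_left]
  by_cases h : e a = e b
  · simp [h]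
  · simp [h, Pi.single_eq_of_ne h]

lemma cs_bessel {F G : Type} [Group F] [Group G] (q : F →* G) (φ : Fin 2 × Fin 2 × F → ℂ)
    (hφ : csPD φ) (C : ℝ) (hC : 1 ≤ C)
    (h1 : ∀ i, φ (i, i, 1) = C) (h0 : ∀ i w, q w = 1 → w ≠ 1 → φ (i, i, w) = 0) (i j s) :
    Summable (fun u : {u // q u = s} => ‖φ (i, j, u)‖ ^ 2) ∧
      ∑' u : {u // q u = s}, ‖φ (i, j, u)‖ ^ 2 ≤ C ^ 2 := by
  obtain ⟨E, _, _, _, k, hk, -⟩ := cs_kolmogorov _ hφ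
  simp only [Matrix.of_apply] at hk
  have hC0 : 0 < C := by linarith
  have hs : Real.sqrt C ^ 2 = C := Real.sq_sqrt hC0.le
  have hs0 : Real.sqrt C ≠ 0 := (Real.sqrt_pos.2 hC0).ne'
  have hnk : ∀ a, ‖k a‖ = Real.sqrt C := by
    intro a
    rw [norm_eq_sqrt_re_inner (𝕜 := ℂ), hk, inv_mul_cancel, h1]
    simp
  have hon : Orthonormal ℂ (fun u : {u // q u = s} => (((Real.sqrt C)⁻¹ : ℝ) : ℂ) • k ((u : F), j)) := by
    constructor
    · intro u
      rw [norm_smul, hnk]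
      simp [abs_of_nonneg (Real.sqrt_nonneg C), hs0]
    · intro u v huv
      change ⟪(((Real.sqrt C)⁻¹ : ℝ) : ℂ) • k ((u : F), j), (((Real.sqrt C)⁻¹ : ℝ) : ℂ) • k ((v : F), j)⟫_ℂ = 0
      rw [inner_smul_left, inner_smul_right, hk]
      simp only
      rw [h0 j _ (by rw [map_mul, map_inv, u.2, v.2, inv_mul_cancel])]
      · simp
      · intro h
        exact huv (Subtype.ext (inv_mul_eq_one.1 h))
  have hin : ∀ u : {u // q u = s}, ‖φ (i, j, u)‖ ^ 2 =
      C * ‖⟪(((Real.sqrt C)⁻¹ : ℝ) : ℂ) • k ((u : F), j), k (1, i)⟫_ℂ‖ ^ 2 := by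
    intro u
    have : φ (i, j, u) = ⟪k (1, i), k ((u : F), j)⟫_ℂ := by rw [hk]; simp
    rw [this, norm_inner_symm, inner_smul_left, norm_mul, mul_pow]
    have e : ‖(starRingEnd ℂ) (((Real.sqrt C)⁻¹ : ℝ) : ℂ)‖ ^ 2 = C⁻¹ := by
      rw [RCLike.norm_conj, Complex.norm_real, norm_inv, inv_pow, Real.norm_eq_abs, sq_abs, hs]
    rw [e, ← mul_assoc, mul_inv_cancel₀ hC0.ne', one_mul]
  simp only [hin]
  refine ⟨(hon.inner_products_summable (x := k (1,i))).mul_left C, ?_⟩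
  rw [tsum_mul_left]
  have := hon.tsum_inner_products_le (x := k (1,i))
  rw [hnk, hs] at this
  nlinarith

/-- degree -/
noncomputable def csDeg {X : Type} : FreeGroup X →* Multiplicative ℤ :=
  FreeGroup.lift fun _ => Multiplicative.ofAdd 1

/-- term -/
noncomputable def csTerm {X H : Type} [NormedAddCommGroup H] [InnerProductSpace ℂ H] [CompleteSpace H]
    (φ : Fin 2 × Fin 2 × FreeGroup X → ℂ) (c : X → H →L[ℂ] H) (i j : Fin 2) (h h' : H)
    (u : FreeGroup X) : ℂ :=
  φ (i, j, u) * (φ (i, j, u) * ⟪h, csPhi c u h'⟫_ℂ *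
    if (csDeg u).toAdd + (j : ℤ) = (i : ℤ) then 1 else 0)

lemma cs_K3 {G H : Type} [Group G] [NormedAddCommGroup H] [InnerProductSpace ℂ H] [CompleteSpace H]
    (q : FreeGroup G →* G) (hq : ∀ g, q (FreeGroup.of g) = g)
    (φ : Fin 2 × Fin 2 × FreeGroup G → ℂ) (hφ : csPD φ)
    (h0 : ∀ i w, q w = 1 → w ≠ 1 → φ (i, i, w) = 0)
    (c : G → H →L[ℂ] H) (hc : ∀ x, ‖c x‖ ≤ 1) :
    (Matrix.of fun a b : G × Fin 2 × H =>
      ∑' u : {u // q u = a.1⁻¹ * b.1}, csTerm φ c a.2.1 b.2.1 a.2.2 b.2.2 u).PosSemidef := by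
  letI : MulAction q.ker (FreeGroup G × Fin 2 × H) :=
    { smul := fun n a => ((n : FreeGroup G) * a.1, a.2)
      one_smul := fun a => by
        change ((1 : FreeGroup G) * a.1, a.2) = a
        simp
      mul_smul := fun m n a => by
        change ((m * n : FreeGroup G) * a.1, a.2) = ((m : FreeGroup G) * (n * a.1), a.2)
        rw [mul_assoc] }
  have hsm : ∀ (n : q.ker) (a : FreeGroup G × Fin 2 × H), n • a = ((n : FreeGroup G) * a.1, a.2) :=
    fun _ _ => rfl
  let K1 : Matrix (FreeGroup G × Fin 2 × H) (FreeGroup G × Fin 2 × H) ℂ :=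
    Matrix.of fun a b => φ (a.2.1, b.2.1, a.1⁻¹ * b.1)
  have hK1 : K1.PosSemidef := hφ.submatrix (fun a : FreeGroup G × Fin 2 × H => (a.1, a.2.1))
  let K2 : Matrix (FreeGroup G × Fin 2 × H) (FreeGroup G × Fin 2 × H) ℂ :=
    Matrix.of fun a b => φ (a.2.1, b.2.1, a.1⁻¹ * b.1) * ⟪a.2.2, csPhi c (a.1⁻¹ * b.1) b.2.2⟫_ℂ *
      if (csDeg (a.1⁻¹ * b.1)).toAdd + (b.2.1 : ℤ) = (a.2.1 : ℤ) then 1 else 0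
  have hK2 : K2.PosSemidef := by
    have p1 := (csPhi_posSemidef c hc).submatrix (fun a : FreeGroup G × Fin 2 × H => (a.1, a.2.2))
    have p2 := cs_eqPD (fun a : FreeGroup G × Fin 2 × H => (csDeg a.1).toAdd + (a.2.1 : ℤ))
    have := (hK1.hadamard p1).hadamard p2
    have heq : K2 = _ := Matrix.ext fun a b => by
      change φ (a.2.1, b.2.1, a.1⁻¹ * b.1) * ⟪a.2.2, csPhi c (a.1⁻¹ * b.1) b.2.2⟫_ℂ *
        (if (csDeg (a.1⁻¹ * b.1)).toAdd + (b.2.1 : ℤ) = (a.2.1 : ℤ) then (1:ℂ) else 0) =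
        φ (a.2.1, b.2.1, a.1⁻¹ * b.1) * ⟪a.2.2, csPhi c (a.1⁻¹ * b.1) b.2.2⟫_ℂ *
        (if (csDeg a.1).toAdd + (a.2.1 : ℤ) = (csDeg b.1).toAdd + (b.2.1 : ℤ) then (1:ℂ) else 0)
      congr 1
      refine if_congr ?_ rfl rfl
      simp only [map_mul, map_inv, toAdd_mul, toAdd_inv]
      omega
    exact heq ▸ this
  have hmain := cs_fiber (N := q.ker) K1 K2 hK1 hK2 ?_ ?_ ?_ ?_
  · have := hmain.submatrix (fun a : G × Fin 2 × H => (FreeGroup.of a.1, a.2))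
    convert this using 1
    ext a b
    simp only [Matrix.of_apply, Matrix.submatrix_apply, hsm]
    let e : q.ker ≃ {u // q u = a.1⁻¹ * b.1} :=
      { toFun := fun v => ⟨(FreeGroup.of a.1)⁻¹ * (v * FreeGroup.of b.1), by
          rw [map_mul, map_mul, map_inv, hq, hq, v.2, one_mul]⟩
        invFun := fun u => ⟨FreeGroup.of a.1 * (u : FreeGroup G) * (FreeGroup.of b.1)⁻¹, by
          rw [MonoidHom.mem_ker, map_mul, map_mul, map_inv, hq, hq, u.2]; group⟩
        left_inv := fun v => by ext; simp [mul_assoc]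
        right_inv := fun u => by ext; simp [mul_assoc] }
    rw [← e.tsum_eq]
    rfl
  · intro v a b
    simp [K1, hsm, mul_assoc]
  · intro v a b
    simp only [K2, hsm, Matrix.of_apply, mul_inv_rev, mul_assoc, inv_mul_cancel_left]
  · intro v a hv
    simp only [K1, hsm, Matrix.of_apply]
    apply h0
    · rw [map_mul, map_mul, v.2, map_inv]; simp
    · intro h
      apply hv
      ext
      rw [inv_mul_eq_one] at h
      simpa using h.symm
  · intro v a hv
    simp only [K2, hsm, Matrix.of_apply]
    rw [h0, zero_mul, zero_mul]
    · rw [map_mul, map_mul, v.2, map_inv]; simp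
    · intro h
      apply hv
      ext
      rw [inv_mul_eq_one] at h
      simpa using h.symm

open Classical in
lemma cs_norm_one {X : Type} (u : FreeGroup X) (hd : (csDeg u).toAdd = 1) :
    (∃ x, u = FreeGroup.of x) ∨ 2 ≤ u.norm := by
  by_cases h2 : 2 ≤ u.norm
  · exact Or.inr h2
  left
  have h : u.norm ≤ 1 := by omega
  have hl : u.toWord.length ≤ 1 := h
  have hm : FreeGroup.mk u.toWord = u := FreeGroup.mk_toWord
  match hL : u.toWord, hl with
  | [], _ =>
    rw [hL] at hm
    rw [← hm, ← FreeGroup.one_eq_mk] at hd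
    simp at hd
  | [(x, true)], _ =>
    rw [hL] at hm
    exact ⟨x, hm.symm⟩
  | [(x, false)], _ =>
    rw [hL] at hm
    have : u = (FreeGroup.of x)⁻¹ := by rw [← hm]; rfl
    rw [this] at hd
    simp [csDeg] at hd
end P10


section P11
variable {G H : Type} [Group G] [NormedAddCommGroup H] [InnerProductSpace ℂ H] [CompleteSpace H]

open Classical in
lemma csPhi_le_one {X : Type} (c : X → H →L[ℂ] H) (hc : ∀ x, ‖c x‖ ≤ 1) (w) : ‖csPhi c w‖ ≤ 1 := by
  simpa using csPhi_norm c 1 zero_le_one hc w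

lemma csTerm_bound {X : Type} (φ : Fin 2 × Fin 2 × FreeGroup X → ℂ) (c : X → H →L[ℂ] H)
    (i j : Fin 2) (h h' : H) (u : FreeGroup X) (r : ℝ) (hr : ‖csPhi c u‖ ≤ r) :
    ‖csTerm φ c i j h h' u‖ ≤ ‖φ (i, j, u)‖ ^ 2 * (r * ‖h‖ * ‖h'‖) := by
  have h1 : ‖⟪h, csPhi c u h'⟫_ℂ‖ ≤ r * ‖h‖ * ‖h'‖ := by
    calc ‖⟪h, csPhi c u h'⟫_ℂ‖ ≤ ‖h‖ * ‖csPhi c u h'‖ := norm_inner_le_norm _ _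
      _ ≤ ‖h‖ * (r * ‖h'‖) := by
        gcongr
        exact (csPhi c u).le_of_opNorm_le hr h'
      _ = r * ‖h‖ * ‖h'‖ := by ring
  have h2 : ‖(if (csDeg u).toAdd + (j : ℤ) = (i : ℤ) then (1:ℂ) else 0)‖ ≤ 1 := by
    split_ifs <;> simp
  unfold csTerm
  rw [norm_mul, norm_mul, norm_mul]
  calc ‖φ (i, j, u)‖ * (‖φ (i, j, u)‖ * ‖⟪h, csPhi c u h'⟫_ℂ‖ * _)
      ≤ ‖φ (i, j, u)‖ * (‖φ (i, j, u)‖ * (r * ‖h‖ * ‖h'‖) * 1) := by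
        have : 0 ≤ r * ‖h‖ * ‖h'‖ := le_trans (norm_nonneg _) h1
        gcongr
    _ = _ := by ring

/-- The interpolating data obtained from the kernel. -/
lemma cs_rep (q : FreeGroup G →* G) (hq : ∀ g, q (FreeGroup.of g) = g)
    (φ : Fin 2 × Fin 2 × FreeGroup G → ℂ) (hφ : csPD φ) (C : ℝ) (hC : 1 ≤ C)
    (h1 : ∀ i, φ (i, i, 1) = C) (h0 : ∀ i w, q w = 1 → w ≠ 1 → φ (i, i, w) = 0)
    (c : G → H →L[ℂ] H) (hc : ∀ x, ‖c x‖ ≤ 1) :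
    ∃ (K : Type) (_ : NormedAddCommGroup K) (_ : InnerProductSpace ℂ K) (_ : CompleteSpace K)
      (π : G →* unitary (K →L[ℂ] K)) (ξ : Fin 2 → H →L[ℂ] K),
      (∀ i, ‖ξ i‖ ≤ C) ∧ ∀ i j s h h', ⟪ξ i h, (π s : K →L[ℂ] K) (ξ j h')⟫_ℂ =
        ∑' u : {u // q u = s}, csTerm φ c i j h h' u := by
  letI : MulAction G (G × Fin 2 × H) :=
    { smul := fun g a => (g * a.1, a.2)
      one_smul := fun a => by
        change ((1 : G) * a.1, a.2) = a
        simp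
      mul_smul := fun m n a => by
        change (m * n * a.1, a.2) = (m * (n * a.1), a.2)
        rw [mul_assoc] }
  have hsm : ∀ (g : G) (a : G × Fin 2 × H), g • a = (g * a.1, a.2) := fun _ _ => rfl
  let T : Fin 2 → Fin 2 → G → H → H → ℂ := fun i j s h h' =>
    ∑' u : {u // q u = s}, csTerm φ c i j h h' u
  have hsum : ∀ i j s h h', Summable fun u : {u // q u = s} => csTerm φ c i j h h' u := by
    intro i j s h h'
    refine Summable.of_norm_bounded
      (((cs_bessel q φ hφ C hC h1 h0 i j s).1).mul_right (1 * ‖h‖ * ‖h'‖)) ?_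
    intro u
    exact csTerm_bound φ c i j h h' u 1 (csPhi_le_one c hc _)
  have hadd : ∀ i j s h x y, T i j s h (x + y) = T i j s h x + T i j s h y := by
    intro i j s h x y
    simp only [T]
    rw [← (hsum i j s h x).tsum_add (hsum i j s h y)]
    congr 1
    ext u
    simp only [csTerm, map_add, inner_add_right]
    ring
  have hsmul : ∀ i j s h (a : ℂ) x, T i j s h (a • x) = a * T i j s h x := by
    intro i j s h a x
    simp only [T]
    rw [← tsum_mul_left]
    congr 1
    ext u
    simp only [csTerm, map_smul, inner_smul_right]
    ring
  have hdiag : ∀ i h, T i i 1 h h = C ^ 2 * ‖h‖ ^ 2 := by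
    intro i h
    simp only [T]
    rw [tsum_eq_single ⟨1, map_one q⟩]
    · simp only [csTerm, h1, csPhi_one, map_one, toAdd_one, zero_add, if_true,
        ContinuousLinearMap.one_apply, inner_self_eq_norm_sq_to_K]
      simp
      ring
    · intro u hu
      have : (u : FreeGroup G) ≠ 1 := fun h => hu (Subtype.ext h)
      simp [csTerm, h0 i u u.2 this]
  obtain ⟨E, _, _, _, k, π, hk, hπ, -⟩ := cs_gns _ (cs_K3 q hq φ hφ h0 c hc) (by
    intro g a b
    have : (g * a.1)⁻¹ * (g * b.1) = a.1⁻¹ * b.1 := by group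
    change T a.2.1 b.2.1 ((g * a.1)⁻¹ * (g * b.1)) a.2.2 b.2.2 = T a.2.1 b.2.1 (a.1⁻¹ * b.1) a.2.2 b.2.2
    rw [this])
  have hkT : ∀ a b, ⟪k a, k b⟫_ℂ = T a.2.1 b.2.1 (a.1⁻¹ * b.1) a.2.2 b.2.2 := hk
  have kadd : ∀ i x y, k (1, i, x + y) = k (1, i, x) + k (1, i, y) := by
    intro i x y
    have key : ∀ b, ⟪k b, k (1, i, x + y) - (k (1, i, x) + k (1, i, y))⟫_ℂ = 0 := by
      intro b
      rw [inner_sub_right, inner_add_right, hkT, hkT, hkT]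
      simp only [hadd]
      ring
    rw [← sub_eq_zero, ← inner_self_eq_zero (𝕜 := ℂ)]
    nth_rewrite 1 [inner_sub_left]
    rw [inner_add_left, key, key, key]
    simp
  have ksmul : ∀ i (a : ℂ) x, k (1, i, a • x) = a • k (1, i, x) := by
    intro i a x
    have key : ∀ b, ⟪k b, k (1, i, a • x) - a • k (1, i, x)⟫_ℂ = 0 := by
      intro b
      rw [inner_sub_right, inner_smul_right, hkT, hkT]
      simp only [hsmul]
      ring
    rw [← sub_eq_zero, ← inner_self_eq_zero (𝕜 := ℂ)]
    nth_rewrite 1 [inner_sub_left]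
    rw [inner_smul_left, key, key]
    simp
  have knorm : ∀ i x, ‖k (1, i, x)‖ ≤ C * ‖x‖ := by
    intro i x
    have e : ((‖k (1, i, x)‖ ^ 2 : ℝ) : ℂ) = ((C * ‖x‖) ^ 2 : ℝ) := by
      have := inner_self_eq_norm_sq_to_K (𝕜 := ℂ) (k (1, i, x))
      rw [hkT] at this
      simp only [inv_one, one_mul, hdiag] at this
      push_cast
      rw [mul_pow]
      exact this.symm
    have e' := Complex.ofReal_injective e
    have : 0 ≤ C * ‖x‖ := by positivity
    exact (pow_le_pow_iff_left₀ (norm_nonneg _) this two_ne_zero).1 e'.le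
  refine ⟨E, _, _, ‹_›, π, fun i => LinearMap.mkContinuous
    { toFun := fun x => k (1, i, x), map_add' := kadd i, map_smul' := ksmul i } C (knorm i), ?_, ?_⟩
  · intro i
    exact LinearMap.mkContinuous_norm_le _ (by linarith) _
  · intro i j s h h'
    change ⟪k (1, i, h), (π s : E →L[ℂ] E) (k (1, j, h'))⟫_ℂ = T i j s h h'
    rw [hπ, hkT, hsm]
    simp

end P11


end CompletelySidonAux

theorem completelySidon_interpolation_operatorValued {G : Type} [Group G] (Λ : Set G)
    (C : ℝ) (hC : 1 ≤ C) (hΛ : IsCompletelySidon Λ C)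
    {H : Type} [NormedAddCommGroup H] [InnerProductSpace ℂ H] [CompleteSpace H]
    (z : ↥Λ → H →L[ℂ] H) (M : ℝ) (hM : M < 1) (hz : ∀ t, ‖z t‖ ≤ M)
    (ε : ℝ) (hε₀ : 0 < ε) (hε₁ : ε ≤ 1) :
    ∃ (K : Type) (_ : NormedAddCommGroup K) (_ : InnerProductSpace ℂ K) (_ : CompleteSpace K)
      (π : G →* unitary (K →L[ℂ] K)) (ξ η : H →L[ℂ] K),
      ‖ξ‖ * ‖η‖ ≤ C ^ 2 / ε ∧
      (∀ t : ↥Λ,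
        (ContinuousLinearMap.adjoint η).comp
          (((π (t : G) : unitary (K →L[ℂ] K)) : K →L[ℂ] K).comp ξ) = z t) ∧
      (∀ s ∉ Λ,
        ‖(ContinuousLinearMap.adjoint η).comp
          (((π s : unitary (K →L[ℂ] K)) : K →L[ℂ] K).comp ξ)‖ ≤ C ^ 2 * ε) := by
  classical
  let q : FreeGroup G →* G := FreeGroup.lift id
  have hq : ∀ g, q (FreeGroup.of g) = g := fun g => by simp [q]
  let c : G → H →L[ℂ] H := fun x => if h : x ∈ Λ then (ε : ℂ) • z ⟨x, h⟩ else 0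
  have hcε : ∀ x, ‖c x‖ ≤ ε := by
    intro x
    by_cases h : x ∈ Λ
    · simp only [c, h, dif_pos, norm_smul, Complex.norm_real, Real.norm_eq_abs, abs_of_pos hε₀]
      have := hz ⟨x, h⟩
      nlinarith
    · simp [c, h, hε₀.le]
  have hc1 : ∀ x, ‖c x‖ ≤ 1 := fun x => (hcε x).trans hε₁
  obtain ⟨φ, hφ, hd, ho⟩ := cs_A Λ C hC hΛ q hq
  have h1 : ∀ i, φ (i, i, 1) = C := fun i => by rw [hd i 1 (map_one q)]; simp
  have h0 : ∀ i w, q w = 1 → w ≠ 1 → φ (i, i, w) = 0 := fun i w hw hw1 => by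
    rw [hd i w hw, if_neg hw1]
  obtain ⟨K, _, _, _, π, ξ, hξ, hin⟩ := cs_rep q hq φ hφ C hC h1 h0 c hc1
  have hε' : (ε : ℂ) ≠ 0 := by exact_mod_cast hε₀.ne'
  have hnε : ‖((ε⁻¹ : ℝ) : ℂ)‖ = ε⁻¹ := by
    rw [Complex.norm_real, Real.norm_eq_abs, abs_of_pos (inv_pos.2 hε₀)]
  have hform : ∀ s h h', inner ℂ h ((ContinuousLinearMap.adjoint (((ε⁻¹ : ℝ) : ℂ) • ξ 1)).comp
          (((π s : unitary (K →L[ℂ] K)) : K →L[ℂ] K).comp (ξ 0)) h') =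
      ((ε⁻¹ : ℝ) : ℂ) * ∑' u : {u // q u = s}, csTerm φ c 1 0 h h' u := by
    intro s h h'
    rw [ContinuousLinearMap.comp_apply, ContinuousLinearMap.adjoint_inner_right,
      ContinuousLinearMap.smul_apply, inner_smul_left, Complex.conj_ofReal,
      ContinuousLinearMap.comp_apply, hin]
  refine ⟨K, _, _, ‹_›, π, ξ 0, ((ε⁻¹ : ℝ) : ℂ) • ξ 1, ?_, ?_, ?_⟩
  · rw [norm_smul, hnε]
    have a0 := hξ 0
    have a1 := hξ 1
    calc ‖ξ 0‖ * (ε⁻¹ * ‖ξ 1‖) ≤ C * (ε⁻¹ * C) := by gcongr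
      _ = C ^ 2 / ε := by field_simp
  · intro t
    ext h'
    refine ext_inner_left ℂ fun h => ?_
    rw [hform, tsum_eq_single ⟨FreeGroup.of (t : G), hq t⟩]
    · have e1 : φ (1, 0, FreeGroup.of (t : G)) = 1 := by
        rw [ho _ (by rw [hq]; exact t.2), hq, if_pos rfl]
      have e2 : c t = (ε : ℂ) • z t := by simp [c]
      simp only [csTerm, e1, csPhi_of, e2, ContinuousLinearMap.smul_apply, inner_smul_right]
      simp [csDeg, hε']
    · intro u hu
      have : φ (1, 0, u) = 0 := by
        rw [ho _ (by rw [u.2]; exact t.2), if_neg]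
        intro h
        apply hu
        apply Subtype.ext
        rw [h, u.2]
      simp [csTerm, this]
  · intro s hs
    refine ContinuousLinearMap.opNorm_le_bound _ (by positivity) fun h' => ?_
    set A := (ContinuousLinearMap.adjoint (((ε⁻¹ : ℝ) : ℂ) • ξ 1)).comp
          (((π s : unitary (K →L[ℂ] K)) : K →L[ℂ] K).comp (ξ 0)) with hA
    have key : ∀ h, ‖inner ℂ h (A h')‖ ≤ C ^ 2 * ε * ‖h'‖ * ‖h‖ := by
      intro h
      rw [hform, norm_mul, hnε]
      obtain ⟨b1, b2⟩ := cs_bessel q φ hφ C hC h1 h0 1 0 s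
      have hb : ∀ u : {u // q u = s}, ‖csTerm φ c 1 0 h h' u‖ ≤
          ‖φ (1, 0, u)‖ ^ 2 * (ε ^ 2 * ‖h‖ * ‖h'‖) := by
        intro u
        by_cases hdeg : (csDeg (u : FreeGroup G)).toAdd = 1
        · rcases cs_norm_one _ hdeg with ⟨x, hx⟩ | hn
          · have : c x = 0 := by
              have : x = s := by rw [← u.2, hx, hq]
              simp [c, this, hs]
            simp only [csTerm, hx, csPhi_of, this]
            simp
            positivity
          · exact csTerm_bound φ c 1 0 h h' u _
              ((csPhi_norm c ε hε₀.le hcε u).trans (pow_le_pow_of_le_one hε₀.le hε₁ hn))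
        · simp [csTerm, hdeg]
          positivity
      have := tsum_of_norm_bounded (b1.mul_right (ε ^ 2 * ‖h‖ * ‖h'‖)).hasSum hb
      rw [tsum_mul_right] at this
      calc ε⁻¹ * ‖∑' u : {u // q u = s}, csTerm φ c 1 0 h h' u‖
          ≤ ε⁻¹ * (C ^ 2 * (ε ^ 2 * ‖h‖ * ‖h'‖)) := by
            gcongr
            exact this.trans (by gcongr)
        _ = C ^ 2 * ε * ‖h'‖ * ‖h‖ := by field_simp
    have k2 := key (A h')
    rw [inner_self_eq_norm_sq_to_K] at k2
    by_cases hz0 : ‖A h'‖ = 0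
    · rw [hz0]; positivity
    · have hp : 0 < ‖A h'‖ := lt_of_le_of_ne (norm_nonneg _) (Ne.symm hz0)
      have : ‖A h'‖ * ‖A h'‖ ≤ C ^ 2 * ε * ‖h'‖ * ‖A h'‖ := by
        simpa [pow_two] using k2
      exact le_of_mul_le_mul_right this hp
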